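/- arXiv:2005.00671 — 4 statements merged into one kernel-verified Lean document; each statement's English description precedes it below -/
import Mathlib

section
/- For all positive integers m and n with 4/5 ≤ m/n < 1 (equivalently, 4n ≤ 5m and m < n), there exists a finite connected simple graph G such that μ(G) = m and ν(G) = n. -/
open Finset

section Defs
variable {V : Type*}

/-- A matching: a set of edges, pairwise non-adjacent. -/
def IsMatchingSet (G : SimpleGraph V) (M : Finset (Sym2 V)) : Prop :=
  ↑M ⊆ G.edgeSet ∧ ∀ e ∈ M, ∀ f ∈ M, e ≠ f → ∀ v : V, v ∈ e → v ∉ f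

/-- A vertex is saturated by a matching if some edge of it is incident to the vertex. -/
def Saturates (M : Finset (Sym2 V)) (v : V) : Prop :=
  ∃ e ∈ M, v ∈ e

/-- ν(G): maximum size of a matching. -/
noncomputable def nuG (G : SimpleGraph V) : ℕ :=
  sSup {n | ∃ M : Finset (Sym2 V), IsMatchingSet G M ∧ M.card = n}

/-- λ(G): maximum of |H| + |H'| over pairs of disjoint matchings. -/
noncomputable def lamG (G : SimpleGraph V) : ℕ :=
  sSup {n | ∃ H H' : Finset (Sym2 V), IsMatchingSet G H ∧ IsMatchingSet G H' ∧
    Disjoint H H' ∧ H.card + H'.card = n}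

/-- Λ(G): set of pairs of disjoint matchings realizing λ(G). -/
def LambdaSet (G : SimpleGraph V) : Set (Finset (Sym2 V) × Finset (Sym2 V)) :=
  {p | IsMatchingSet G p.1 ∧ IsMatchingSet G p.2 ∧ Disjoint p.1 p.2 ∧
    p.1.card + p.2.card = lamG G}

/-- μ(G): maximum of |H| over pairs (H, H') ∈ Λ(G). -/
noncomputable def muG (G : SimpleGraph V) : ℕ :=
  sSup {n | ∃ p ∈ LambdaSet G, p.1.card = n}

/-- Λ_μ(G): pairs in Λ(G) with |H| = μ(G). -/
def LambdaMuSet (G : SimpleGraph V) : Set (Finset (Sym2 V) × Finset (Sym2 V)) :=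
  {p | p ∈ LambdaSet G ∧ p.1.card = muG G}

end Defs

section Matchings
variable {V : Type*} {G : SimpleGraph V}

/-- If each vertex of `S` lies on at most one edge of `E`, then there are at most `#S` incidences
between `S` and `E`. -/
lemma sum_card_incident_le [DecidableEq V] {S : Finset V} {E : Finset (Sym2 V)}
    (h : ∀ v ∈ S, ∀ e ∈ E, ∀ f ∈ E, v ∈ e → v ∈ f → e = f) :
    ∑ e ∈ E, #{v ∈ S | v ∈ e} ≤ #S := by
  have := Finset.sum_card_bipartiteAbove_eq_sum_card_bipartiteBelow
    (s := S) (t := E) (fun v e => v ∈ e)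
  simp only [Finset.bipartiteAbove, Finset.bipartiteBelow] at this
  rw [← this, Finset.card_eq_sum_ones]
  refine Finset.sum_le_sum fun v hv => Finset.card_le_one.2 fun e he e' he' => ?_
  simp only [Finset.mem_filter] at he he'
  exact h v hv e he.1 e' he'.1 he.2 he'.2

lemma IsMatchingSet.eq_of_mem {M : Finset (Sym2 V)} (hM : IsMatchingSet G M) {e f : Sym2 V}
    (he : e ∈ M) (hf : f ∈ M) {v : V} (hve : v ∈ e) (hvf : v ∈ f) : e = f := by
  by_contra hne
  exact hM.2 e he f hf hne v hve hvf

lemma isMatchingSet_image [DecidableEq V] {ι : Type*} [Fintype ι] {g : ι → Sym2 V}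
    (hG : ∀ i, g i ∈ G.edgeSet) (hg : ∀ i j v, v ∈ g i → v ∈ g j → i = j) :
    IsMatchingSet G (Finset.univ.image g) ∧ #(Finset.univ.image g) = Fintype.card ι := by
  refine ⟨⟨?_, ?_⟩, ?_⟩
  · intro e he
    obtain ⟨i, -, rfl⟩ := Finset.mem_image.1 he
    exact hG i
  · intro e he e' he' hne v hv hv'
    obtain ⟨i, -, rfl⟩ := Finset.mem_image.1 he
    obtain ⟨j, -, rfl⟩ := Finset.mem_image.1 he'
    exact hne (congrArg g (hg i j v hv hv'))
  · rw [Finset.card_image_of_injective, Finset.card_univ]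
    intro i j hij
    have hi := Sym2.out_fst_mem (g i)
    exact hg i j _ hi (hij ▸ hi)

end Matchings

section LegGraph
variable {C L : Type*}

/-- The graph obtained from the complete graph on the set `C` of centres by attaching, for each
`l : L`, a path with two edges to the centre `f l`. The inner vertex of this path is
`Sum.inr (Sum.inl l)`, the outer one is `Sum.inr (Sum.inr l)`. -/
def legGraph (f : L → C) : SimpleGraph (C ⊕ (L ⊕ L)) :=
  SimpleGraph.fromRel fun u v =>
    (∃ c d, u = Sum.inl c ∧ v = Sum.inl d) ∨
    (∃ l, u = Sum.inl (f l) ∧ v = Sum.inr (Sum.inl l)) ∨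
    (∃ l, u = Sum.inr (Sum.inl l) ∧ v = Sum.inr (Sum.inr l))

lemma legGraph_adj_centres (f : L → C) {c d : C} (h : c ≠ d) :
    (legGraph f).Adj (Sum.inl c) (Sum.inl d) := by
  simp [legGraph, h]

lemma legGraph_adj_inner (f : L → C) (l : L) :
    (legGraph f).Adj (Sum.inl (f l)) (Sum.inr (Sum.inl l)) := by
  simp [legGraph]

lemma legGraph_adj_outer (f : L → C) (l : L) :
    (legGraph f).Adj (Sum.inr (Sum.inl l)) (Sum.inr (Sum.inr l)) := by
  simp [legGraph]

lemma mem_edgeSet_legGraph {f : L → C} {e : Sym2 (C ⊕ (L ⊕ L))} (he : e ∈ (legGraph f).edgeSet) :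
    (∃ c d, c ≠ d ∧ e = s(Sum.inl c, Sum.inl d)) ∨
    (∃ l, e = s(Sum.inl (f l), Sum.inr (Sum.inl l))) ∨
    (∃ l, e = s(Sum.inr (Sum.inl l), Sum.inr (Sum.inr l))) := by
  induction e with
  | _ u v =>
    rw [SimpleGraph.mem_edgeSet, legGraph, SimpleGraph.fromRel_adj] at he
    obtain ⟨hne, h | h⟩ := he
    · rcases h with ⟨c, d, rfl, rfl⟩ | ⟨l, rfl, rfl⟩ | ⟨l, rfl, rfl⟩
      · exact Or.inl ⟨c, d, by simpa using hne, rfl⟩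
      · exact Or.inr (Or.inl ⟨l, rfl⟩)
      · exact Or.inr (Or.inr ⟨l, rfl⟩)
    · rcases h with ⟨c, d, rfl, rfl⟩ | ⟨l, rfl, rfl⟩ | ⟨l, rfl, rfl⟩
      · exact Or.inl ⟨d, c, by simpa using hne, rfl⟩
      · exact Or.inr (Or.inl ⟨l, Sym2.eq_swap⟩)
      · exact Or.inr (Or.inr ⟨l, Sym2.eq_swap⟩)

lemma legGraph_connected [Nonempty C] (f : L → C) : (legGraph f).Connected := by
  obtain ⟨c⟩ := ‹Nonempty C›
  have hcentre : ∀ d, (legGraph f).Reachable (Sum.inl c) (Sum.inl d) := by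
    intro d
    by_cases h : c = d
    · rw [h]
    · exact (legGraph_adj_centres f h).reachable
  have hinner l := (hcentre (f l)).trans (legGraph_adj_inner f l).reachable
  refine SimpleGraph.connected_iff_exists_forall_reachable _ |>.2 ⟨Sum.inl c, ?_⟩
  rintro (d | l | l)
  · exact hcentre d
  · exact hinner l
  · exact (hinner l).trans (legGraph_adj_outer f l).reachable

section Counts
variable [Fintype L] [DecidableEq C] [DecidableEq L]

/-- The number of centres on `e`. -/
def centreCount [Fintype C] (e : Sym2 (C ⊕ (L ⊕ L))) : ℕ :=
  #{v ∈ (Finset.univ : Finset C).map ⟨Sum.inl, Sum.inl_injective⟩ | v ∈ e}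

/-- The number of inner leg vertices on `e`. -/
def innerCount (e : Sym2 (C ⊕ (L ⊕ L))) : ℕ :=
  #{v ∈ (Finset.univ : Finset L).map
    ⟨fun l => Sum.inr (Sum.inl l), Sum.inr_injective.comp Sum.inl_injective⟩ | v ∈ e}

/-- The number of outer leg vertices on `e`. -/
def outerCount (e : Sym2 (C ⊕ (L ⊕ L))) : ℕ :=
  #{v ∈ (Finset.univ : Finset L).map
    ⟨fun l => Sum.inr (Sum.inr l), Sum.inr_injective.comp Sum.inr_injective⟩ | v ∈ e}

lemma legGraph_counts [Fintype C] {f : L → C} {e : Sym2 (C ⊕ (L ⊕ L))}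
    (he : e ∈ (legGraph f).edgeSet) :
    centreCount e + innerCount e + outerCount e = 2 ∧ 1 ≤ centreCount e + outerCount e := by
  rcases mem_edgeSet_legGraph he with ⟨c, d, hcd, rfl⟩ | ⟨l, rfl⟩ | ⟨l, rfl⟩ <;>
    simp [centreCount, innerCount, outerCount, Finset.filter_map,
      Finset.filter_or, Finset.filter_eq', *]

lemma IsMatchingSet.legGraph_bounds [Fintype C] {f : L → C}
    {M : Finset (Sym2 (C ⊕ (L ⊕ L)))} (hM : IsMatchingSet (legGraph f) M) :
    ∑ e ∈ M, centreCount e ≤ Fintype.card C ∧ ∑ e ∈ M, innerCount e ≤ Fintype.card L ∧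
    ∑ e ∈ M, outerCount e ≤ Fintype.card L ∧
    ∑ e ∈ M, centreCount e + ∑ e ∈ M, innerCount e + ∑ e ∈ M, outerCount e = 2 * #M ∧
    #M ≤ ∑ e ∈ M, centreCount e + ∑ e ∈ M, outerCount e := by
  have key (S : Finset (C ⊕ (L ⊕ L))) := sum_card_incident_le (S := S) (E := M)
    fun v _ e he e' he' hv hv' => hM.eq_of_mem he he' hv hv'
  refine ⟨?_, ?_, ?_, ?_, ?_⟩
  · simpa only [centreCount, Finset.card_map, Finset.card_univ] using key (Finset.univ.map _)
  · simpa only [innerCount, Finset.card_map, Finset.card_univ] using key (Finset.univ.map _)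
  · simpa only [outerCount, Finset.card_map, Finset.card_univ] using key (Finset.univ.map _)
  · rw [← Finset.sum_add_distrib, ← Finset.sum_add_distrib,
      Finset.sum_congr rfl fun e he => (legGraph_counts (hM.1 he)).1]
    simp [mul_comm]
  · rw [← Finset.sum_add_distrib, Finset.card_eq_sum_ones]
    exact Finset.sum_le_sum fun e he => (legGraph_counts (hM.1 he)).2

lemma sum_outerCount_add_le {f : L → C} {H H' : Finset (Sym2 (C ⊕ (L ⊕ L)))}
    (hH : IsMatchingSet (legGraph f) H) (hH' : IsMatchingSet (legGraph f) H')
    (hd : Disjoint H H') :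
    ∑ e ∈ H, outerCount e + ∑ e ∈ H', outerCount e ≤ Fintype.card L := by
  rw [← Finset.sum_union hd]
  have key : ∀ l : L, ∀ e ∈ H ∪ H', Sum.inr (Sum.inr l) ∈ e →
      e = s(Sum.inr (Sum.inl l), Sum.inr (Sum.inr l)) := by
    intro l e he hl
    have he : e ∈ (legGraph f).edgeSet := (Finset.mem_union.1 he).elim (hH.1 ·) (hH'.1 ·)
    rcases mem_edgeSet_legGraph he with ⟨c, d, -, rfl⟩ | ⟨l, rfl⟩ | ⟨l, rfl⟩ <;> simp_all
  have := sum_card_incident_le (E := H ∪ H') (S := (Finset.univ : Finset L).map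
    ⟨fun l => Sum.inr (Sum.inr l), Sum.inr_injective.comp Sum.inr_injective⟩) (by
      intro v hv e he e' he' hve hve'
      obtain ⟨l, -, rfl⟩ := Finset.mem_map.1 hv
      rw [key l e he hve, key l e' he' hve'])
  simpa only [outerCount, Finset.card_map, Finset.card_univ] using this

end Counts

variable [Fintype C] [Fintype L]

/-- If every centre carries two distinguished legs, the leg graph has two disjoint matchings of
sizes `|L|` and `2 * |C|`. -/
lemma exists_disjoint_matchings_legGraph (f : L → C) (p : C → Bool → L)
    (hf : ∀ c x, f (p c x) = c) (hp : ∀ c, p c true ≠ p c false) :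
    ∃ H H', IsMatchingSet (legGraph f) H ∧ IsMatchingSet (legGraph f) H' ∧ Disjoint H H' ∧
      #H = Fintype.card L ∧ #H' = 2 * Fintype.card C := by
  classical
  have hinj : ∀ c d x y, p c x = p d y → c = d ∧ x = y := by
    intro c d x y h
    have hcd : c = d := by rw [← hf c x, h, hf]
    subst hcd
    refine ⟨rfl, ?_⟩
    have hc := hp c
    cases x <;> cases y <;> first | rfl | exact absurd h hc | exact absurd h.symm hc
  let g : L → Sym2 (C ⊕ (L ⊕ L)) := fun l =>
    if l = p (f l) true then s(Sum.inl (f l), Sum.inr (Sum.inl l))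
    else s(Sum.inr (Sum.inl l), Sum.inr (Sum.inr l))
  let g' : C × Bool → Sym2 (C ⊕ (L ⊕ L)) := fun q =>
    if q.2 then s(Sum.inr (Sum.inl (p q.1 q.2)), Sum.inr (Sum.inr (p q.1 q.2)))
    else s(Sum.inl (f (p q.1 q.2)), Sum.inr (Sum.inl (p q.1 q.2)))
  obtain ⟨h₁, h₂⟩ := isMatchingSet_image (G := legGraph f) (g := g)
    (by
      intro l
      simp only [g]
      split_ifs
      exacts [legGraph_adj_inner f l, legGraph_adj_outer f l])
    (by
      intro l l' v hv hv'
      simp only [g] at hv hv'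
      split_ifs at hv hv' with h h' h' <;> simp only [Sym2.mem_iff] at hv hv' <;>
        rcases hv with rfl | rfl <;> simp at hv' <;> first | exact hv' | (rw [h, h', hv']))
  obtain ⟨h₃, h₄⟩ := isMatchingSet_image (G := legGraph f) (g := g')
    (by
      rintro ⟨c, _ | _⟩
      exacts [legGraph_adj_inner f _, legGraph_adj_outer f _])
    (by
      rintro ⟨c, x⟩ ⟨d, y⟩ v hv hv'
      cases x <;> cases y <;> simp only [g', Sym2.mem_iff, if_true, Bool.false_eq_true, if_false]
        at hv hv' <;> rcases hv with rfl | rfl <;> simp [hf] at hv' <;>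
        first
          | (rw [hv'])
          | (obtain ⟨rfl, h⟩ := hinj _ _ _ _ hv'; simp at h ⊢))
  refine ⟨_, _, h₁, h₃, ?_, h₂, ?_⟩
  · rw [Finset.disjoint_left]
    intro e he he'
    obtain ⟨l, -, rfl⟩ := Finset.mem_image.1 he
    obtain ⟨⟨c, x⟩, -, h⟩ := Finset.mem_image.1 he'
    simp only [g, g'] at h
    split_ifs at h with hx hl hl <;> simp at h
    · exact hl (by rw [← h, hf, show x = true from hx])
    · obtain ⟨-, rfl⟩ := h
      rw [hf] at hl
      exact hx (hinj _ _ _ _ hl).2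
  · rw [h₄]
    simp [mul_comm]

lemma lamG_legGraph (f : L → C) (p : C → Bool → L) (hf : ∀ c x, f (p c x) = c)
    (hp : ∀ c, p c true ≠ p c false) :
    lamG (legGraph f) = Fintype.card L + 2 * Fintype.card C := by
  refine IsGreatest.csSup_eq ⟨?_, ?_⟩
  · obtain ⟨H, H', h, h', hd, hc, hc'⟩ := exists_disjoint_matchings_legGraph f p hf hp
    exact ⟨H, H', h, h', hd, by rw [hc, hc']⟩
  · rintro _ ⟨H, H', h, h', hd, rfl⟩
    classical
    have := h.legGraph_bounds
    have := h'.legGraph_bounds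
    have := sum_outerCount_add_le h h' hd
    omega

lemma muG_legGraph (f : L → C) (p : C → Bool → L) (hf : ∀ c x, f (p c x) = c)
    (hp : ∀ c, p c true ≠ p c false) : muG (legGraph f) = Fintype.card L := by
  have hlam := lamG_legGraph f p hf hp
  refine IsGreatest.csSup_eq ⟨?_, ?_⟩
  · obtain ⟨H, H', h, h', hd, hc, hc'⟩ := exists_disjoint_matchings_legGraph f p hf hp
    exact ⟨(H, H'), ⟨h, h', hd, by rw [hc, hc', hlam]⟩, hc⟩
  · rintro _ ⟨⟨H, H'⟩, ⟨h, h', hd, hsum⟩, rfl⟩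
    dsimp only at *
    classical
    have := h.legGraph_bounds
    have := h'.legGraph_bounds
    have := sum_outerCount_add_le h h' hd
    omega

end LegGraph

lemma nuG_legGraph {K L : Type*} [Fintype K] [Fintype L] (f : L → K × Bool) :
    nuG (legGraph f) = Fintype.card L + Fintype.card K := by
  classical
  refine IsGreatest.csSup_eq ⟨?_, ?_⟩
  · obtain ⟨h, hc⟩ := isMatchingSet_image (G := legGraph f) (ι := L ⊕ K)
      (g := Sum.elim (fun l => s(Sum.inr (Sum.inl l), Sum.inr (Sum.inr l)))
        fun i => s(Sum.inl (i, false), Sum.inl (i, true)))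
      (by
        rintro (l | i)
        exacts [legGraph_adj_outer f l, legGraph_adj_centres f (by simp)])
      (by
        rintro (l | i) (l' | i') v hv hv' <;> simp only [Sum.elim_inl, Sum.elim_inr, Sym2.mem_iff]
          at hv hv' <;> rcases hv with rfl | rfl <;> simp_all)
    exact ⟨_, h, by rw [hc, Fintype.card_sum]⟩
  · rintro _ ⟨M, hM, rfl⟩
    have := hM.legGraph_bounds
    simp only [Fintype.card_prod, Fintype.card_bool] at this
    omega

/-- For all positive integers m, n with 4/5 ≤ m/n < 1 there is a finite connected
graph G with μ(G) = m and ν(G) = n. -/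
theorem stmt0 (m n : ℕ) (hm : 0 < m) (hn : 0 < n) (h1 : 4 * n ≤ 5 * m) (h2 : m < n) :
    ∃ (V : Type) (_ : Fintype V) (G : SimpleGraph V),
      G.Connected ∧ muG G = m ∧ nuG G = n := by
  classical
  obtain ⟨k, rfl⟩ : ∃ k, n = m + k := ⟨n - m, by omega⟩
  obtain ⟨r, rfl⟩ : ∃ r, m = 4 * k + r := ⟨m - 4 * k, by omega⟩
  have hk : 0 < k := by omega
  let C := Fin k × Bool
  let L := (C × Bool) ⊕ Fin r
  let f : L → C := Sum.elim Prod.fst fun _ => (⟨0, hk⟩, false)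
  have hL : Fintype.card L = 4 * k + r := by
    simp only [L, C, Fintype.card_sum, Fintype.card_prod, Fintype.card_fin, Fintype.card_bool]
    ring
  have : Nonempty C := ⟨(⟨0, hk⟩, false)⟩
  refine ⟨C ⊕ (L ⊕ L), inferInstance, legGraph f, legGraph_connected f, ?_, ?_⟩
  · rw [muG_legGraph f (fun c x => Sum.inl (c, x)) (fun _ _ => rfl)
      (fun _ h => by simpa using Sum.inl_injective h), hL]
  · rw [nuG_legGraph f, hL, Fintype.card_fin]
end

section
/- If G is a finite connected simple graph with μ(G) < ν(G) (equivalently μ(G)/ν(G) < 1), then G contains a diamond spanner as a subgraph, i.e., there exist an integer d ≥ 0 and an injective graph homomorphism from the diamond spanner with d diamonds into G. -/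
open Finset

/-- Vertex type of the diamond spanner with d diamonds: two central vertices
(`Sum.inl`), four legs of two vertices each (`Sum.inr ∘ Sum.inl`), and d diamonds
of four vertices each (`Sum.inr ∘ Sum.inr`). In diamond i, vertex (i,0) = pᵢ and
(i,1) = qᵢ are the endpoints (degree-2 vertices) and (i,2), (i,3) are the other two. -/
abbrev DiamondSpannerV (d : ℕ) : Type := Fin 2 ⊕ (Fin 4 × Fin 2) ⊕ (Fin d × Fin 4)

/-- The diamond spanner with d diamonds: central vertices a = Sum.inl 0 and
b = Sum.inl 1, two legs attached to each of a and b, and a chain from a to b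
consisting of d diamonds (K₄ minus an edge) joined in series; if d = 0 the chain
is just the edge ab. -/
def diamondSpanner (d : ℕ) : SimpleGraph (DiamondSpannerV d) :=
  SimpleGraph.fromRel (fun u v =>
    -- central edge, present only when there are no diamonds
    (d = 0 ∧ u = Sum.inl 0 ∧ v = Sum.inl 1) ∨
    -- inner edges of the four legs (legs 0,1 at a; legs 2,3 at b)
    (∃ i : Fin 4, u = Sum.inl (if (i : ℕ) < 2 then 0 else 1) ∧
      v = Sum.inr (Sum.inl (i, 0))) ∨
    -- outer edges of the four legs
    (∃ i : Fin 4, u = Sum.inr (Sum.inl (i, 0)) ∧ v = Sum.inr (Sum.inl (i, 1))) ∨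
    -- internal edges of each diamond: K₄ on {pᵢ,qᵢ,rᵢ,sᵢ} minus the edge pᵢqᵢ
    (∃ (i : Fin d) (x y : Fin 4),
      ((x, y) = ((0 : Fin 4), (2 : Fin 4)) ∨ (x, y) = (0, 3) ∨ (x, y) = (1, 2) ∨
        (x, y) = (1, 3) ∨ (x, y) = (2, 3)) ∧
      u = Sum.inr (Sum.inr (i, x)) ∧ v = Sum.inr (Sum.inr (i, y))) ∨
    -- chain edge a p₁
    (∃ i : Fin d, (i : ℕ) = 0 ∧ u = Sum.inl 0 ∧ v = Sum.inr (Sum.inr (i, 0))) ∨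
    -- chain edges qᵢ pᵢ₊₁
    (∃ i j : Fin d, (j : ℕ) = (i : ℕ) + 1 ∧
      u = Sum.inr (Sum.inr (i, 1)) ∧ v = Sum.inr (Sum.inr (j, 0))) ∨
    -- chain edge q_d b
    (∃ i : Fin d, (i : ℕ) = d - 1 ∧ u = Sum.inr (Sum.inr (i, 1)) ∧ v = Sum.inl 1))

/-- A diamond spanner exists in `G`. -/
def HasDiamondSpanner {V : Type*} (G : SimpleGraph V) : Prop :=
  ∃ (d : ℕ) (f : DiamondSpannerV d → V), Function.Injective f ∧
    ∀ x y : DiamondSpannerV d, (diamondSpanner d).Adj x y → G.Adj (f x) (f y)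

theorem hasDiamondSpanner_of_parts {V : Type*} {G : SimpleGraph V} {X W : Set V} {d : ℕ}
    {a x₁ y₁ x₂ y₂ b x₃ y₃ x₄ y₄ : V} {D : Fin d → Fin 4 → V}
    (hA : [a, x₁, y₁, x₂, y₂].Nodup) (hAX : ∀ v ∈ [a, x₁, y₁, x₂, y₂], v ∈ X)
    (hB : [b, x₃, y₃, x₄, y₄].Nodup)
    (hBX : ∀ v ∈ [b, x₃, y₃, x₄, y₄], v ∉ X ∧ v ∉ W)
    (hDW : ∀ i k, D i k ∈ W ∧ D i k ∉ X)
    (hD : ∀ i j k l, D i k = D j l → i = j ∧ k = l)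
    (h₁ : G.Adj a x₁) (h₁' : G.Adj x₁ y₁) (h₂ : G.Adj a x₂) (h₂' : G.Adj x₂ y₂)
    (h₃ : G.Adj b x₃) (h₃' : G.Adj x₃ y₃) (h₄ : G.Adj b x₄) (h₄' : G.Adj x₄ y₄)
    (h₀ : d = 0 → G.Adj a b)
    (h02 : ∀ i, G.Adj (D i 0) (D i 2)) (h03 : ∀ i, G.Adj (D i 0) (D i 3))
    (h12 : ∀ i, G.Adj (D i 1) (D i 2)) (h13 : ∀ i, G.Adj (D i 1) (D i 3))
    (h23 : ∀ i, G.Adj (D i 2) (D i 3))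
    (hfirst : ∀ i : Fin d, (i : ℕ) = 0 → G.Adj a (D i 0))
    (hstep : ∀ i j : Fin d, (j : ℕ) = i + 1 → G.Adj (D i 1) (D j 0))
    (hlast : ∀ i : Fin d, (i : ℕ) = d - 1 → G.Adj (D i 1) b) :
    HasDiamondSpanner G := by
  let l : List V := [a, x₁, y₁, x₂, y₂] ++ [b, x₃, y₃, x₄, y₄]
  have hl : l.Nodup := by
    refine List.nodup_append.2 ⟨hA, hB, fun u hu v hv huv => ?_⟩
    exact (hBX v hv).1 (huv ▸ hAX u hu)
  have hlD : ∀ v ∈ l, ∀ i k, v ≠ D i k := by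
    rintro v hv i k rfl
    rcases List.mem_append.1 hv with hv | hv
    · exact (hDW i k).2 (hAX _ hv)
    · exact (hBX _ hv).2 (hDW i k).1
  let c : Fin 2 ⊕ (Fin 4 × Fin 2) → Fin 10 := Sum.elim ![0, 5]
    (fun p => ![![1, 2], ![3, 4], ![6, 7], ![8, 9]] p.1 p.2)
  have hc : Function.Injective c := by
    have : ∀ x y, c x = c y → x = y := by decide
    exact this
  let g : Fin 2 ⊕ (Fin 4 × Fin 2) → V := fun z => l.get (c z)
  have hg : Function.Injective g := (List.nodup_iff_injective_get.1 hl).comp hc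
  have hgD : ∀ z i k, g z ≠ D i k := fun z => hlD _ (List.get_mem _ _)
  let f : DiamondSpannerV d → V :=
    Sum.elim (g ∘ Sum.inl) (Sum.elim (g ∘ Sum.inr) (fun p => D p.1 p.2))
  refine ⟨d, f, ?_, ?_⟩
  · rintro (c | c | ⟨i, k⟩) (c' | c' | ⟨j, l⟩) hf <;>
      simp only [f, Sum.elim_inl, Sum.elim_inr, Function.comp_apply] at hf
    · rw [Sum.inl_injective (hg hf)]
    · cases hg hf
    · exact absurd hf (hgD _ _ _)
    · cases hg hf
    · rw [Sum.inr_injective (hg hf)]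
    · exact absurd hf (hgD _ _ _)
    · exact absurd hf.symm (hgD _ _ _)
    · exact absurd hf.symm (hgD _ _ _)
    · obtain ⟨rfl, rfl⟩ := hD _ _ _ _ hf; rfl
  · suffices H : ∀ x y : DiamondSpannerV d, ((d = 0 ∧ x = Sum.inl 0 ∧ y = Sum.inl 1) ∨
        (∃ i : Fin 4, x = Sum.inl (if (i : ℕ) < 2 then 0 else 1) ∧
          y = Sum.inr (Sum.inl (i, 0))) ∨
        (∃ i : Fin 4, x = Sum.inr (Sum.inl (i, 0)) ∧ y = Sum.inr (Sum.inl (i, 1))) ∨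
        (∃ (i : Fin d) (k l : Fin 4),
          ((k, l) = ((0 : Fin 4), (2 : Fin 4)) ∨ (k, l) = (0, 3) ∨ (k, l) = (1, 2) ∨
            (k, l) = (1, 3) ∨ (k, l) = (2, 3)) ∧
          x = Sum.inr (Sum.inr (i, k)) ∧ y = Sum.inr (Sum.inr (i, l))) ∨
        (∃ i : Fin d, (i : ℕ) = 0 ∧ x = Sum.inl 0 ∧ y = Sum.inr (Sum.inr (i, 0))) ∨
        (∃ i j : Fin d, (j : ℕ) = (i : ℕ) + 1 ∧
          x = Sum.inr (Sum.inr (i, 1)) ∧ y = Sum.inr (Sum.inr (j, 0))) ∨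
        (∃ i : Fin d, (i : ℕ) = d - 1 ∧ x = Sum.inr (Sum.inr (i, 1)) ∧ y = Sum.inl 1)) →
        G.Adj (f x) (f y) by
      intro x y hxy
      rw [diamondSpanner, SimpleGraph.fromRel_adj] at hxy
      rcases hxy.2 with h | h
      · exact H x y h
      · exact (H y x h).symm
    rintro x y (⟨hd, rfl, rfl⟩ | ⟨i, rfl, rfl⟩ | ⟨i, rfl, rfl⟩ | ⟨i, k, l, hkl, rfl, rfl⟩ |
      ⟨i, hi, rfl, rfl⟩ | ⟨i, j, hij, rfl, rfl⟩ | ⟨i, hi, rfl, rfl⟩)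
    · exact h₀ hd
    · fin_cases i
      exacts [h₁, h₂, h₃, h₄]
    · fin_cases i
      exacts [h₁', h₂', h₃', h₄']
    · simp only [Prod.mk.injEq] at hkl
      rcases hkl with ⟨rfl, rfl⟩ | ⟨rfl, rfl⟩ | ⟨rfl, rfl⟩ | ⟨rfl, rfl⟩ | ⟨rfl, rfl⟩
      exacts [h02 i, h03 i, h12 i, h13 i, h23 i]
    · exact hfirst i hi
    · exact hstep i j hij
    · exact hlast i hi

/-- Two disjoint matchings `h`, `h'` and a matching `m`, given as involutions, in which an edge
of `m` outside `h ∪ h'` has both ends covered by `h` and by `h'`, and every neighbour in `h ∪ h'`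
of such an end is covered by `m`. -/
structure TightTriple {V : Type*} (G : SimpleGraph V) (h h' m : V → V) : Prop where
  inv : ∀ x, h (h x) = x
  inv' : ∀ x, h' (h' x) = x
  invm : ∀ x, m (m x) = x
  adj : ∀ x, h x ≠ x → G.Adj x (h x)
  adj' : ∀ x, h' x ≠ x → G.Adj x (h' x)
  adjm : ∀ x, m x ≠ x → G.Adj x (m x)
  disj : ∀ x, h x ≠ x → h' x ≠ h x
  cov : ∀ x, m x ≠ x → m x ≠ h x → m x ≠ h' x → h x ≠ x ∧ h' x ≠ x
  sat : ∀ x, m x ≠ x → m x ≠ h x → m x ≠ h' x → m (h x) ≠ h x ∧ m (h' x) ≠ h' x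

/-- The vertex `x` lies on an edge of `m` outside `h ∪ h'`. -/
def Unused {V : Type*} (h h' m : V → V) (x : V) : Prop :=
  m x ≠ x ∧ m x ≠ h x ∧ m x ≠ h' x

/-- The entry vertices of the successive diamonds met when leaving from `a` along `m`. -/
def chainEntry {V : Type*} (h h' m : V → V) (a : V) : ℕ → V
  | 0 => m a
  | n + 1 => m (h (h' (chainEntry h h' m a n)))

/-- The four vertices of the alternating cycle through `p`. -/
def InQuad {V : Type*} (h h' : V → V) (p v : V) : Prop :=
  v = p ∨ v = h p ∨ v = h' p ∨ v = h (h' p)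

/-- `p` is an endpoint of a diamond whose middle edge lies in `m`. -/
def IsDiamondEnd {V : Type*} (h h' m : V → V) (p : V) : Prop :=
  h (h' p) = h' (h p) ∧ m (h p) = h' p

/-- The vertices of the first `n` diamonds of the chain from `a`. -/
def chainSet {V : Type*} (h h' m : V → V) (a : V) (n : ℕ) : Set V :=
  {v | ∃ i < n, InQuad h h' (chainEntry h h' m a i) v}

/-- The first `n` steps of the chain from `a` meet diamonds outside `X`. -/
def IsDiamondChain {V : Type*} (h h' m : V → V) (X : Set V) (a : V) (n : ℕ) : Prop :=
  ∀ i < n, chainEntry h h' m a i ∉ X ∧ IsDiamondEnd h h' m (chainEntry h h' m a i)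

namespace TightTriple

variable {V : Type*} {G : SimpleGraph V} {h h' m : V → V}

theorem swap (T : TightTriple G h h' m) : TightTriple G h' h m where
  inv := T.inv'
  inv' := T.inv
  invm := T.invm
  adj := T.adj'
  adj' := T.adj
  adjm := T.adjm
  disj x hx := by
    intro e
    exact T.disj x (by rwa [e]) e.symm
  cov x h1 h2 h3 := (T.cov x h1 h3 h2).symm
  sat x h1 h2 h3 := (T.sat x h1 h3 h2).symm

theorem unused_match (T : TightTriple G h h' m) {x : V} (hx : Unused h h' m x) :
    Unused h h' m (m x) := by
  obtain ⟨h1, h2, h3⟩ := hx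
  have := T.inv; have := T.inv'; have := T.invm
  refine ⟨?_, ?_, ?_⟩ <;> grind

theorem next_ne (T : TightTriple G h h' m) {x : V} (hx : Unused h h' m x) :
    h' (h x) ≠ h x := by
  obtain ⟨h1, h2, h3⟩ := hx
  have s := (T.sat x h1 h2 h3).1
  have := T.inv x; have := T.inv'; have := T.invm
  have := T.cov (h x)
  grind

theorem nodup_legs (T : TightTriple G h h' m) {x : V} (hx : Unused h h' m x)
    (hc : h (h' x) ≠ h' (h x)) : [x, h x, h' (h x), h' x, h (h' x)].Nodup := by
  have n1 := T.next_ne hx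
  have n2 := T.swap.next_ne (x := x) ⟨hx.1, hx.2.2, hx.2.1⟩
  obtain ⟨c1, c2⟩ := T.cov x hx.1 hx.2.1 hx.2.2
  have d := T.disj x c1
  have := T.inv; have := T.inv'
  simp only [List.nodup_cons, List.mem_cons, List.not_mem_nil, not_or, or_false,
      not_false_eq_true, List.nodup_nil, and_true]
  grind

theorem nodup_quad (T : TightTriple G h h' m) {x : V} (hx : Unused h h' m x)
    (hc : h (h' x) = h' (h x)) : [x, h x, h' x, h (h' x)].Nodup := by
  have n1 := T.next_ne hx
  have n2 := T.swap.next_ne (x := x) ⟨hx.1, hx.2.2, hx.2.1⟩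
  obtain ⟨c1, c2⟩ := T.cov x hx.1 hx.2.1 hx.2.2
  have d := T.disj x c1
  have := T.inv; have := T.inv'
  simp only [List.nodup_cons, List.mem_cons, List.not_mem_nil, not_or, or_false,
      not_false_eq_true, List.nodup_nil, and_true]
  grind

theorem adj_legs (T : TightTriple G h h' m) {x : V} (hx : Unused h h' m x) :
    G.Adj x (h x) ∧ G.Adj (h x) (h' (h x)) :=
  ⟨T.adj x (T.cov x hx.1 hx.2.1 hx.2.2).1, T.adj' _ (T.next_ne hx)⟩

theorem unused_opposite (T : TightTriple G h h' m) {p : V} (hp : Unused h h' m p)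
    (hd : IsDiamondEnd h h' m p) : Unused h h' m (h p) ∧ Unused h h' m (h (h' p)) := by
  obtain ⟨hc, hm⟩ := hd
  have n := T.nodup_quad hp hc
  simp only [List.nodup_cons, List.mem_cons, List.not_mem_nil, not_or, or_false,
      not_false_eq_true, List.nodup_nil, and_true] at n
  have i1 := T.inv; have i2 := T.inv'; have i3 := T.invm
  have hr : Unused h h' m (h p) := by
    refine ⟨?_, ?_, ?_⟩ <;> grind
  have s := (T.sat _ hr.1 hr.2.1 hr.2.2).2
  refine ⟨hr, ?_, ?_, ?_⟩ <;> grind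

theorem inQuad_closed (T : TightTriple G h h' m) {p v : V} (hc : h (h' p) = h' (h p)) :
    (InQuad h h' p (h v) ↔ InQuad h h' p v) ∧ (InQuad h h' p (h' v) ↔ InQuad h h' p v) := by
  have i1 := T.inv; have i2 := T.inv'
  unfold InQuad
  constructor <;> grind

variable {X : Set V} {a : V} {d : ℕ}

theorem chainSet_closed (T : TightTriple G h h' m) (hC : IsDiamondChain h h' m X a d) (v : V) :
    (h v ∈ chainSet h h' m a d ↔ v ∈ chainSet h h' m a d) ∧
      (h' v ∈ chainSet h h' m a d ↔ v ∈ chainSet h h' m a d) := by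
  constructor
  · refine exists_congr fun i => and_congr_right fun hi => ?_
    exact (T.inQuad_closed (hC i hi).2.1).1
  · refine exists_congr fun i => and_congr_right fun hi => ?_
    exact (T.inQuad_closed (hC i hi).2.1).2

theorem chainSet_disjoint (hC : IsDiamondChain h h' m X a d)
    (hX : ∀ v, h v ∈ X ↔ v ∈ X) (hX' : ∀ v, h' v ∈ X ↔ v ∈ X) {v : V}
    (hv : v ∈ chainSet h h' m a d) : v ∉ X := by
  obtain ⟨i, hi, hv⟩ := hv
  have := (hC i hi).1
  rcases hv with rfl | rfl | rfl | rfl <;> simpa [hX, hX']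

theorem chainSet_succ (n : ℕ) (v : V) : v ∈ chainSet h h' m a (n + 1) ↔
    v ∈ chainSet h h' m a n ∨ InQuad h h' (chainEntry h h' m a n) v := by
  simp only [chainSet, Set.mem_ofPred_eq, Nat.lt_succ_iff_lt_or_eq]
  grind

theorem isDiamondChain_succ (n : ℕ) : IsDiamondChain h h' m X a (n + 1) ↔
    IsDiamondChain h h' m X a n ∧ chainEntry h h' m a n ∉ X ∧
      IsDiamondEnd h h' m (chainEntry h h' m a n) := by
  simp only [IsDiamondChain, Nat.lt_succ_iff_lt_or_eq]
  grind

theorem chain_spec (T : TightTriple G h h' m) (hX : ∀ v, h v ∈ X ↔ v ∈ X)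
    (hX' : ∀ v, h' v ∈ X ↔ v ∈ X) (haX : a ∈ X) (ha : Unused h h' m a) :
    ∀ d, IsDiamondChain h h' m X a d →
      Unused h h' m (chainEntry h h' m a d) ∧
      (m (chainEntry h h' m a d) = a ∨ m (chainEntry h h' m a d) ∈ chainSet h h' m a d) ∧
      chainEntry h h' m a d ∉ chainSet h h' m a d ∧ chainEntry h h' m a d ≠ a ∧
      ∀ w, w = a ∨ w ∈ chainSet h h' m a d →
        m w = chainEntry h h' m a d ∨ m w = a ∨ m w ∈ chainSet h h' m a d := by
  intro d
  induction d with
  | zero =>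
    intro _
    have : ∀ w, w ∉ chainSet h h' m a 0 := by
      rintro w ⟨i, hi, _⟩
      omega
    refine ⟨T.unused_match ha, .inl (T.invm a), this _, ha.1, ?_⟩
    rintro w (rfl | hw)
    · exact .inl rfl
    · exact absurd hw (this w)
  | succ k ih =>
    intro hC
    obtain ⟨hC, hpX, hd⟩ := (isDiamondChain_succ k).1 hC
    obtain ⟨hp, hmp, hpW, hpa, hcl⟩ := ih hC
    have hcl2 := T.chainSet_closed hC
    have hdis := fun v => chainSet_disjoint hC hX hX' (v := v)
    obtain ⟨hr, hq⟩ := T.unused_opposite hp hd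
    simp only [chainSet_succ]
    have e : chainEntry h h' m a (k + 1) = m (h (h' (chainEntry h h' m a k))) := rfl
    rw [e]
    generalize chainEntry h h' m a k = p at *
    have n := T.nodup_quad hp hd.1
    simp only [List.nodup_cons, List.mem_cons, List.not_mem_nil, not_or, or_false,
      not_false_eq_true, List.nodup_nil, and_true] at n
    have hqX : h (h' p) ∉ X := by rwa [hX, hX']
    have hqW : h (h' p) ∉ chainSet h h' m a k := by rwa [(hcl2 _).1, (hcl2 _).2]
    have i3 := T.invm
    have hd2 := hd.2
    have hd3 : m (h' p) = h p := by rw [← hd2, i3]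
    have key : ∀ w, w = a ∨ w ∈ chainSet h h' m a k ∨ InQuad h h' p w →
        m w = m (h (h' p)) ∨ m w = a ∨ m w ∈ chainSet h h' m a k ∨ InQuad h h' p (m w) := by
      rintro w (rfl | hw | rfl | rfl | rfl | rfl)
      · rcases hcl w (.inl rfl) with h | h | h
        · exact .inr (.inr (.inr (.inl h)))
        · exact .inr (.inl h)
        · exact .inr (.inr (.inl h))
      · rcases hcl w (.inr hw) with h | h | h
        · exact .inr (.inr (.inr (.inl h)))
        · exact .inr (.inl h)
        · exact .inr (.inr (.inl h))
      · rcases hmp with h | h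
        · exact .inr (.inl h)
        · exact .inr (.inr (.inl h))
      · exact .inr (.inr (.inr (.inr (.inr (.inl hd2)))))
      · exact .inr (.inr (.inr (.inr (.inl hd3))))
      · exact .inl rfl
    have hout : ∀ w, w = a ∨ w ∈ chainSet h h' m a k ∨ InQuad h h' p w →
        m (h (h' p)) ≠ w := by
      rintro w hw rfl
      rcases hw with hw | hw | hw | hw | hw | hw
      · have := hcl _ (.inl rfl); grind
      · have := hcl _ (.inr hw); grind
      · have := i3 (h (h' p)); grind
      · have := i3 (h (h' p)); grind
      · have := i3 (h (h' p)); grind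
      · exact hq.1 hw
    refine ⟨T.unused_match hq, .inr (.inr ?_), ?_, ?_, ?_⟩
    · rw [i3]; exact .inr (.inr (.inr rfl))
    · exact fun h => hout _ (.inr h) rfl
    · exact hout a (.inl rfl)
    · exact key

theorem hasDiamondSpanner_of_chain (T : TightTriple G h h' m) (hX : ∀ v, h v ∈ X ↔ v ∈ X)
    (hX' : ∀ v, h' v ∈ X ↔ v ∈ X) (haX : a ∈ X) (ha : Unused h h' m a)
    (hbig : h (h' a) ≠ h' (h a)) (hC : IsDiamondChain h h' m X a d) {x₃ y₃ x₄ y₄ : V}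
    (hB : [chainEntry h h' m a d, x₃, y₃, x₄, y₄].Nodup)
    (hBX : ∀ v ∈ [chainEntry h h' m a d, x₃, y₃, x₄, y₄], v ∉ X ∧ v ∉ chainSet h h' m a d)
    (h₃ : G.Adj (chainEntry h h' m a d) x₃) (h₃' : G.Adj x₃ y₃)
    (h₄ : G.Adj (chainEntry h h' m a d) x₄) (h₄' : G.Adj x₄ y₄) :
    HasDiamondSpanner G := by
  have hU : ∀ i ≤ d, Unused h h' m (chainEntry h h' m a i) := fun i hi =>
    (T.chain_spec hX hX' haX ha i fun j hj => hC j (by omega)).1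
  have hQ : ∀ i < d, Unused h h' m (h (h' (chainEntry h h' m a i))) := fun i hi =>
    (T.unused_opposite (hU i hi.le) (hC i hi).2).2
  have ha' : Unused h' h m a := ⟨ha.1, ha.2.2, ha.2.1⟩
  obtain ⟨l₁, l₁'⟩ := T.adj_legs ha
  obtain ⟨l₂, l₂'⟩ := T.swap.adj_legs ha'
  let D : Fin d → Fin 4 → V := fun i => ![chainEntry h h' m a i,
    h (h' (chainEntry h h' m a i)), h (chainEntry h h' m a i), h' (chainEntry h h' m a i)]
  have hDQ : ∀ (i : Fin d) k, InQuad h h' (chainEntry h h' m a i) (D i k) := by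
    intro i k
    fin_cases k
    exacts [.inl rfl, .inr (.inr (.inr rfl)), .inr (.inl rfl), .inr (.inr (.inl rfl))]
  have hDW : ∀ i k, D i k ∈ chainSet h h' m a d := fun i k => ⟨i, i.2, hDQ i k⟩
  have hne : ∀ (i j : Fin d) k l, i < j → D i k ≠ D j l := by
    intro i j k l hij he
    have hCj : IsDiamondChain h h' m X a j := fun n hn => hC n (by omega)
    have hj := (T.chain_spec hX hX' haX ha j hCj).2.2.1
    have h1 : D i k ∈ chainSet h h' m a j := ⟨i, hij, hDQ i k⟩
    have hcl := T.chainSet_closed hCj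
    have h2 := hDQ j l
    rw [← he] at h2
    rcases h2 with h2 | h2 | h2 | h2 <;> rw [h2] at h1 <;> try simp only [hcl] at h1
    all_goals exact hj h1
  have eD : ∀ i : Fin d, [D i 0, D i 2, D i 3, D i 1].Nodup := fun i =>
    T.nodup_quad (hU i i.2.le) (hC i i.2).2.1
  refine hasDiamondSpanner_of_parts (X := X) (W := chainSet h h' m a d) (d := d) (D := D)
    (T.nodup_legs ha hbig) ?_ hB hBX (fun i k => ⟨hDW i k, ?_⟩) ?_ l₁ l₁' l₂ l₂'
    h₃ h₃' h₄ h₄' ?_ ?_ ?_ ?_ ?_ ?_ ?_ ?_ ?_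
  · simp [hX, hX', haX]
  · exact chainSet_disjoint hC hX hX' (hDW i k)
  · intro i j k l he
    rcases lt_trichotomy i j with hij | rfl | hij
    · exact absurd he (hne i j k l hij)
    · refine ⟨rfl, ?_⟩
      have := eD i
      simp only [List.nodup_cons, List.mem_cons, List.not_mem_nil, not_or, or_false,
        not_false_eq_true, List.nodup_nil, and_true] at this
      fin_cases k <;> fin_cases l <;> first | rfl | (exfalso; revert he; simp; grind)
    · exact absurd he.symm (hne j i l k hij)
  · rintro rfl
    exact T.adjm a ha.1
  · exact fun i => (T.adj_legs (hU i i.2.le)).1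
  · exact fun i => (T.swap.adj_legs (x := chainEntry h h' m a i)
      ⟨(hU i i.2.le).1, (hU i i.2.le).2.2, (hU i i.2.le).2.1⟩).1
  · intro i
    have := (T.adj_legs (hU i i.2.le)).2
    rw [← (hC i i.2).2.1] at this
    exact this.symm
  · exact fun i => (T.swap.adj_legs (x := chainEntry h h' m a i)
      ⟨(hU i i.2.le).1, (hU i i.2.le).2.2, (hU i i.2.le).2.1⟩).2.symm
  · intro i
    have := T.adjm _ (T.unused_opposite (hU i i.2.le) (hC i i.2).2).1.1
    rwa [(hC i i.2).2.2] at this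
  · intro i hi
    have := T.adjm a ha.1
    simpa [D, hi, chainEntry] using this
  · intro i j hij
    have := T.adjm _ (hQ i i.2).1
    simpa [D, hij, chainEntry] using this
  · intro i hi
    have := T.adjm _ (hQ i i.2).1
    have e : d = i + 1 := by omega
    have e2 : chainEntry h h' m a d = m (h (h' (chainEntry h h' m a i))) := by
      conv_lhs => rw [e]
      rfl
    rw [e2]
    exact this

theorem hasDiamondSpanner_of_big (T : TightTriple G h h' m) (hX : ∀ v, h v ∈ X ↔ v ∈ X)
    (hX' : ∀ v, h' v ∈ X ↔ v ∈ X) (haX : a ∈ X) (ha : Unused h h' m a)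
    (hbig : h (h' a) ≠ h' (h a)) (hC : IsDiamondChain h h' m X a d)
    (hb : chainEntry h h' m a d ∉ X)
    (hbb : h (h' (chainEntry h h' m a d)) ≠ h' (h (chainEntry h h' m a d))) :
    HasDiamondSpanner G := by
  obtain ⟨hU, -, hW, -⟩ := T.chain_spec hX hX' haX ha d hC
  have hcl := T.chainSet_closed hC
  have hU' : Unused h' h m (chainEntry h h' m a d) := ⟨hU.1, hU.2.2, hU.2.1⟩
  obtain ⟨l₁, l₁'⟩ := T.adj_legs hU
  obtain ⟨l₂, l₂'⟩ := T.swap.adj_legs hU'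
  refine T.hasDiamondSpanner_of_chain hX hX' haX ha hbig hC (T.nodup_legs hU hbb) ?_
    l₁ l₁' l₂ l₂'
  simp [hX, hX', hcl, hb, hW]

theorem hasDiamondSpanner_of_quad (T : TightTriple G h h' m) (hX : ∀ v, h v ∈ X ↔ v ∈ X)
    (hX' : ∀ v, h' v ∈ X ↔ v ∈ X) (haX : a ∈ X) (ha : Unused h h' m a)
    (hbig : h (h' a) ≠ h' (h a)) (hC : IsDiamondChain h h' m X a d) {p r s : V}
    (hpd : chainEntry h h' m a d = p) (hb : p ∉ X) (hbb : h (h' p) = h' (h p))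
    (hrs : r = h p ∧ s = h' p ∨ r = h' p ∧ s = h p)
    (hw : m r ∉ X) (hwQ : ¬ InQuad h h' p (m r)) :
    HasDiamondSpanner G := by
  obtain ⟨hU, -, hW, -, hcW⟩ := T.chain_spec hX hX' haX ha d hC
  have hcl := T.chainSet_closed hC
  have hch := @hasDiamondSpanner_of_chain V G h h' m X a d T hX hX' haX ha hbig hC r (m r) s
    (h (h' p))
  rw [hpd] at hU hW hcW hch
  have hU' : Unused h' h m p := ⟨hU.1, hU.2.2, hU.2.1⟩
  obtain ⟨l₁, l₁'⟩ := T.adj_legs hU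
  obtain ⟨l₂, l₂'⟩ := T.swap.adj_legs hU'
  have n := T.nodup_quad hU hbb
  have hwW : m r ∉ chainSet h h' m a d := by
    intro hmem
    have := hcW _ (.inr hmem)
    rw [T.invm] at this
    have hrX : r ∉ X := by rcases hrs with ⟨rfl, -⟩ | ⟨rfl, -⟩ <;> simpa [hX, hX']
    have hrW : r ∉ chainSet h h' m a d := by
      rcases hrs with ⟨rfl, -⟩ | ⟨rfl, -⟩ <;> simpa [hcl]
    simp only [List.nodup_cons, List.mem_cons, List.not_mem_nil, not_or, or_false,
      not_false_eq_true, List.nodup_nil, and_true] at n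
    grind
  have hmr : m r ≠ r := by
    rintro e
    rw [e] at hwQ
    refine hwQ ?_
    rcases hrs with ⟨rfl, -⟩ | ⟨rfl, -⟩
    exacts [.inr (.inl rfl), .inr (.inr (.inl rfl))]
  simp only [InQuad, not_or] at hwQ
  refine hch ?_ ?_ ?_ (T.adjm r hmr) ?_ ?_
  · simp only [List.nodup_cons, List.mem_cons, List.not_mem_nil, not_or, or_false,
      not_false_eq_true, List.nodup_nil, and_true] at n ⊢
    grind
  · rcases hrs with ⟨rfl, rfl⟩ | ⟨rfl, rfl⟩ <;> simp [hX, hX', hcl, hb, hW, hw, hwW]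
  · rcases hrs with ⟨rfl, rfl⟩ | ⟨rfl, rfl⟩ <;> assumption
  · rcases hrs with ⟨rfl, rfl⟩ | ⟨rfl, rfl⟩ <;> assumption
  · rcases hrs with ⟨rfl, rfl⟩ | ⟨rfl, rfl⟩
    · exact l₂'
    · rwa [hbb]

theorem even_card_of_involution {S : Finset V} {f : V → V} (hf : ∀ x, f (f x) = x)
    (hS : ∀ x ∈ S, f x ∈ S) (hne : ∀ x ∈ S, f x ≠ x) : Even S.card := by
  have : ∑ _x ∈ S, (1 : ZMod 2) = 0 :=
    Finset.sum_involution (fun x _ => f x) (fun _ _ => by decide) (fun x hx _ => hne x hx)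
      (fun x hx => hS x hx) (fun x _ => hf x)
  simpa [ZMod.natCast_eq_zero_iff_even] using this

theorem hasDiamondSpanner_of_odd [Fintype V] (T : TightTriple G h h' m) {X : Finset V}
    (hX : ∀ v, h v ∈ X ↔ v ∈ X) (hX' : ∀ v, h' v ∈ X ↔ v ∈ X) (hodd : Odd X.card)
    (hm : ∀ v ∈ X, m v ≠ v) (hbig : ∀ a ∈ X, Unused h h' m a → h (h' a) ≠ h' (h a)) :
    HasDiamondSpanner G := by
  classical
  by_contra hno
  have hXs : ∀ v, h v ∈ (X : Set V) ↔ v ∈ (X : Set V) := hX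
  have hXs' : ∀ v, h' v ∈ (X : Set V) ↔ v ∈ (X : Set V) := hX'
  have hout : ∀ a ∈ X, m a ∉ X → Unused h h' m a := by
    intro a ha hma
    refine ⟨hm a ha, fun e => hma ?_, fun e => hma ?_⟩
    · rw [e]; exact (hX a).2 ha
    · rw [e]; exact (hX' a).2 ha
  let R : V → Prop := fun p => p ∉ X ∧ h (h' p) = h' (h p) ∧ ∃ a ∈ X, m a ∉ X ∧
    ∃ d, IsDiamondChain h h' m X a d ∧ chainEntry h h' m a d = p
  let S : Finset V := {v | v ∈ X ∨ ∃ p, R p ∧ InQuad h h' p v}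
  have memS : ∀ v, v ∈ S ↔ v ∈ X ∨ ∃ p, R p ∧ InQuad h h' p v := fun v => by simp [S]
  have hentry : ∀ a ∈ X, m a ∉ X → ∀ d, IsDiamondChain h h' m X a d →
      chainEntry h h' m a d ∈ S := by
    intro a ha hma d hC
    rw [memS]
    by_cases hb : chainEntry h h' m a d ∈ X
    · exact .inl hb
    · by_cases hbb : h (h' (chainEntry h h' m a d)) = h' (h (chainEntry h h' m a d))
      · exact .inr ⟨_, ⟨hb, hbb, a, ha, hma, d, hC, rfl⟩, .inl rfl⟩
      · exact absurd (T.hasDiamondSpanner_of_big hXs hXs' ha (hout a ha hma)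
          (hbig a ha (hout a ha hma)) hC hb hbb) hno
  have hchain0 : ∀ a, IsDiamondChain h h' m X a 0 := fun a i hi => absurd hi (by omega)
  have hSX : ∀ v ∈ X, m v ∈ S := by
    intro v hv
    by_cases hmv : m v ∈ X
    · exact (memS _).2 (.inl hmv)
    · exact hentry v hv hmv 0 (hchain0 v)
  have hSQ : ∀ p, R p → ∀ v, InQuad h h' p v → m v ≠ v ∧ m v ∈ S := by
    rintro p ⟨hpX, hpc, a, ha, hma, d, hC, hpd⟩ v hv
    have haU := hout a ha hma
    have hab := hbig a ha haU
    obtain ⟨hU, hmp, hW, -, -⟩ := T.chain_spec hXs hXs' ha haU d hC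
    have hcl := T.chainSet_closed hC
    have hcS : ∀ w ∈ chainSet h h' m a d, w ∈ S := by
      rintro w ⟨i, hi, hw⟩
      exact (memS w).2 (.inr ⟨_, ⟨(hC i hi).1, (hC i hi).2.1, a, ha, hma, i,
        fun j hj => hC j (by omega), rfl⟩, hw⟩)
    have hR : R p := ⟨hpX, hpc, a, ha, hma, d, hC, hpd⟩
    have hQS : ∀ w, InQuad h h' p w → w ∈ S := fun w hw => (memS w).2 (.inr ⟨p, hR, hw⟩)
    have hQX : ∀ w, InQuad h h' p w → w ∉ X := by
      rintro w (rfl | rfl | rfl | rfl) <;> simpa [hX, hX']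
    have hquad := @hasDiamondSpanner_of_quad V G h h' m X a d T hXs hXs' ha haU hab hC p
    have hnext : IsDiamondEnd h h' m p → m (h (h' p)) ∈ S := by
      intro hd
      have := hentry a ha hma (d + 1)
        ((isDiamondChain_succ d).2 ⟨hC, by rwa [hpd], by rwa [hpd]⟩)
      rwa [chainEntry, hpd] at this
    rw [hpd] at hU hmp hW
    have hmpQ : ¬ InQuad h h' p (m p) := by
      intro hq
      rcases hmp with hmp | hmp
      · exact hQX _ hq (by rwa [hmp])
      · rcases hq with hq | hq | hq | hq <;> rw [hq] at hmp <;> try simp only [hcl] at hmp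
        all_goals exact hW hmp
    have hmpS : m p ∈ S := by
      rcases hmp with hmp | hmp
      · rw [hmp]; exact (memS a).2 (.inl ha)
      · exact hcS _ hmp
    have n := T.nodup_quad hU hpc
    simp only [List.nodup_cons, List.mem_cons, List.not_mem_nil, not_or, or_false,
      not_false_eq_true, List.nodup_nil, and_true] at n
    have i3 := T.invm
    obtain ⟨sr, ss⟩ := T.sat p hU.1 hU.2.1 hU.2.2
    by_cases hd : IsDiamondEnd h h' m p
    · have hd' : m (h' p) = h p := by rw [← hd.2, i3]
      rcases hv with rfl | rfl | rfl | rfl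
      · exact ⟨hU.1, hmpS⟩
      · exact ⟨sr, hQS _ (.inr (.inr (.inl hd.2)))⟩
      · exact ⟨ss, hQS _ (.inr (.inl hd'))⟩
      · exact ⟨(T.unused_opposite hU hd).2.1, hnext hd⟩
    · have hd2 : m (h p) ≠ h' p := fun e => hd ⟨hpc, e⟩
      have side : ∀ r s, r = h p ∧ s = h' p ∨ r = h' p ∧ s = h p → m r ∈ S := by
        intro r s hrs
        by_contra hmr
        exact hno (hquad hpd hpX hpc hrs (fun e => hmr ((memS _).2 (.inl e)))
          (fun e => hmr (hQS _ e)))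
      have far : m (h (h' p)) ≠ h p → ¬ InQuad h h' p (m (h p)) := by
        intro hq e
        unfold InQuad at e hmpQ
        have := i3 (h p)
        grind
      rcases hv with rfl | rfl | rfl | rfl
      · exact ⟨hU.1, hmpS⟩
      · exact ⟨sr, side _ _ (.inl ⟨rfl, rfl⟩)⟩
      · exact ⟨ss, side _ _ (.inr ⟨rfl, rfl⟩)⟩
      · have hq : m (h (h' p)) = h p ∨ ¬ InQuad h h' p (m (h p)) := by
          by_cases e : m (h (h' p)) = h p
          exacts [.inl e, .inr (far e)]
        rcases hq with hq | hq
        · exact ⟨by rw [hq]; exact n.2.1.2, by rw [hq]; exact hQS _ (.inr (.inl rfl))⟩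
        have hrU : Unused h h' m (h p) := by
          refine ⟨sr, ?_, ?_⟩ <;> intro e <;> refine hq ?_ <;> rw [e]
          · rw [T.inv]; exact .inl rfl
          · rw [← hpc]; exact .inr (.inr (.inr rfl))
        refine ⟨by rw [hpc]; exact (T.sat _ hrU.1 hrU.2.1 hrU.2.2).2, ?_⟩
        by_contra hmq
        have hwX : m (h p) ∈ X := by
          by_contra hwX
          exact hno (hquad hpd hpX hpc (.inl ⟨rfl, rfl⟩) hwX hq)
        have hmw : m (m (h p)) = h p := i3 _
        have hwU : Unused h h' m (m (h p)) := T.unused_match hrU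
        have hrX : h p ∉ X := by rwa [hX]
        have hqq : ∀ w, InQuad h h' (h p) w → InQuad h h' p w := by
          have i1 := T.inv
          unfold InQuad
          grind
        refine hno (T.hasDiamondSpanner_of_quad hXs hXs' hwX hwU (hbig _ hwX hwU)
          (hchain0 _) (p := h p) (r := h' (h p)) (s := h (h p)) hmw hrX ?_ (.inr ⟨rfl, rfl⟩)
          ?_ ?_)
        · rw [← hpc, T.inv, T.inv]
        · intro e
          rw [← hpc] at e
          exact hmq ((memS _).2 (.inl e))
        · intro e
          rw [← hpc] at e
          exact hmq (hQS _ (hqq _ e))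
  have hS1 : Even S.card := by
    refine even_card_of_involution T.invm ?_ ?_ <;> intro x hx <;>
      rcases (memS x).1 hx with hx | ⟨p, hp, hx⟩
    exacts [hSX x hx, (hSQ p hp x hx).2, hm x hx, (hSQ p hp x hx).1]
  have hS2 : Even (S \ X).card := by
    refine even_card_of_involution T.inv ?_ ?_ <;> intro x hx <;>
      rw [Finset.mem_sdiff, memS] at hx <;>
      obtain ⟨p, hp, hxq⟩ := hx.1.resolve_left hx.2
    · rw [Finset.mem_sdiff, memS, hX]
      exact ⟨.inr ⟨p, hp, (T.inQuad_closed hp.2.1).1.2 hxq⟩, hx.2⟩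
    · obtain ⟨hpX, hpc, a, ha, hma, d, hC, rfl⟩ := hp
      have hU := (T.chain_spec hXs hXs' ha (hout a ha hma) d hC).1
      have n := T.nodup_quad hU hpc
      simp only [List.nodup_cons, List.mem_cons, List.not_mem_nil, not_or, or_false,
        not_false_eq_true, List.nodup_nil, and_true] at n
      have i1 := T.inv
      unfold InQuad at hxq
      generalize chainEntry h h' m a d = p at *
      clear hSQ hSX hentry memS
      grind
  have hsub : X ⊆ S := fun v hv => (memS v).2 (.inl hv)
  have := Finset.card_sdiff_add_card_eq_card hsub
  rw [← this] at hS1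
  exact Nat.not_even_iff_odd.2 hodd ((Nat.even_add.1 hS1).1 hS2)

end TightTriple

section Extremal

variable {V : Type*} {G : SimpleGraph V}

/-- A matching of `G`, given as the involution exchanging the ends of its edges. -/
def IsMatchInv (G : SimpleGraph V) (f : V → V) : Prop :=
  (∀ x, f (f x) = x) ∧ ∀ x, f x ≠ x → G.Adj x (f x)

/-- The matchings given by two involutions are disjoint. -/
def DisjInv (f g : V → V) : Prop :=
  ∀ x, f x ≠ x → g x ≠ f x

theorem DisjInv.symm {f g : V → V} (hd : DisjInv f g) : DisjInv g f := by
  intro x hx e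
  exact hd x (by rwa [e]) e.symm

open Classical in
/-- The number of vertices moved by `f`. -/
noncomputable def moved [Fintype V] (f : V → V) : ℕ :=
  #{x | f x ≠ x}

open Classical in
/-- The number of vertices covered by edges of `m` in `h ∪ h'`. -/
noncomputable def common [Fintype V] (h h' m : V → V) : ℕ :=
  #{x | m x ≠ x ∧ (m x = h x ∨ m x = h' x)}

theorem common_swap [Fintype V] (h h' m : V → V) : common h h' m = common h' h m := by
  unfold common
  congr 1
  ext x
  simp only [Finset.mem_filter_univ]
  rw [or_comm (a := m x = h x)]

/-- The triples `(h, h', m)` where `(h, h')` has maximum total size, then `h` has maximum size,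
`m` is larger than `h`, and `m` shares as many edges as possible with `h ∪ h'`. -/
structure ExtremalTriple [Fintype V] (G : SimpleGraph V) (h h' m : V → V) : Prop where
  left : IsMatchInv G h
  right : IsMatchInv G h'
  match_m : IsMatchInv G m
  disj : DisjInv h h'
  sum_max : ∀ k k', IsMatchInv G k → IsMatchInv G k' → DisjInv k k' →
    moved k + moved k' ≤ moved h + moved h'
  left_max : ∀ k k', IsMatchInv G k → IsMatchInv G k' → DisjInv k k' →
    moved k + moved k' = moved h + moved h' → moved k ≤ moved h
  common_max : ∀ k k' n, IsMatchInv G k → IsMatchInv G k' → IsMatchInv G n → DisjInv k k' →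
    moved k = moved h → moved k' = moved h' → moved n = moved m →
    common k k' n ≤ common h h' m
  lt : moved h < moved m

open Classical in
/-- Add the edge `uv` to the matching `f`, removing the edges it meets. -/
noncomputable def forceEdge (f : V → V) (u v x : V) : V :=
  if x = u then v else if x = v then u else if x = f u ∨ x = f v then x else f x

theorem isMatchInv_forceEdge {f : V → V} (hf : IsMatchInv G f) {u v : V}
    (huv : G.Adj u v) : IsMatchInv G (forceEdge f u v) := by
  have h1 := hf.1
  have h2 := huv.ne
  constructor
  · intro x
    unfold forceEdge
    grind
  · intro x hx
    unfold forceEdge at hx ⊢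
    split_ifs at hx ⊢ with c1 c2 c3
    · rwa [c1]
    · rw [c2]; exact huv.symm
    · exact absurd rfl hx
    · exact hf.2 x hx

theorem moved_forceEdge [Fintype V] {f : V → V} (hf : ∀ x, f (f x) = x) {u v : V}
    (huv : u ≠ v) (hu : f u = u) :
    (f v ≠ v → moved (forceEdge f u v) = moved f) ∧
      (f v = v → moved f < moved (forceEdge f u v)) := by
  classical
  unfold moved
  constructor
  · intro hv
    refine Finset.card_bij (fun x _ => if x = u then f v else x) ?_ ?_ ?_
    · simp only [Finset.mem_filter_univ, forceEdge]
      grind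
    · intro a₁ ha₁ a₂ ha₂
      simp only [forceEdge] at ha₁ ha₂
      grind
    · simp only [Finset.mem_filter_univ, forceEdge]
      intro b hb
      refine ⟨if b = f v then u else b, ?_, ?_⟩ <;> grind
  · intro hv
    refine Finset.card_lt_card ((Finset.ssubset_iff_of_subset ?_).2 ⟨u, ?_, ?_⟩)
    · intro x
      simp only [Finset.mem_filter_univ, forceEdge]
      grind
    · simp only [forceEdge]
      grind
    · simpa

theorem common_lt_of [Fintype V] {h h' m k k' n : V → V} {u : V}
    (hsub : ∀ x, m x ≠ x → m x = h x ∨ m x = h' x → n x ≠ x ∧ (n x = k x ∨ n x = k' x))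
    (hu : ¬ (m u ≠ u ∧ (m u = h u ∨ m u = h' u)))
    (hu' : n u ≠ u ∧ (n u = k u ∨ n u = k' u)) : common h h' m < common k k' n := by
  classical
  refine Finset.card_lt_card ((Finset.ssubset_iff_of_subset ?_).2 ⟨u, ?_, ?_⟩)
  · intro x
    simp only [Finset.mem_filter_univ]
    exact fun hx => hsub x hx.1 hx.2
  · simpa using hu'
  · simpa using hu

/-- The part of extremality that does not distinguish `h` from `h'`. -/
structure WeakExtremal [Fintype V] (G : SimpleGraph V) (h h' m : V → V) : Prop where
  left : IsMatchInv G h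
  right : IsMatchInv G h'
  match_m : IsMatchInv G m
  disj : DisjInv h h'
  sum_max : ∀ k k', IsMatchInv G k → IsMatchInv G k' → DisjInv k k' →
    moved k + moved k' ≤ moved h + moved h'
  common_max : ∀ k k' n, IsMatchInv G k → IsMatchInv G k' → IsMatchInv G n → DisjInv k k' →
    moved k = moved h → moved k' = moved h' → moved n = moved m →
    common k k' n ≤ common h h' m

namespace WeakExtremal

variable [Fintype V] {h h' m : V → V}

theorem swap (E : WeakExtremal G h h' m) : WeakExtremal G h' h m where
  left := E.right
  right := E.left
  match_m := E.match_m
  disj := E.disj.symm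
  sum_max k k' hk hk' hd := by
    have := E.sum_max k k' hk hk' hd
    omega
  common_max k k' n hk hk' hn hd e e' en := by
    rw [common_swap k k' n, common_swap h' h m]
    exact E.common_max k' k n hk' hk hn hd.symm e' e en

theorem covered (E : WeakExtremal G h h' m) {u : V} (h1 : m u ≠ u) (h2 : m u ≠ h u)
    (h3 : m u ≠ h' u) : h u ≠ u := by
  intro hu
  have ih := E.left.1; have ih' := E.right.1; have im := E.match_m.1
  have hadj := E.match_m.2 u h1
  have hk := isMatchInv_forceEdge E.left hadj
  have hd : DisjInv (forceEdge h u (m u)) h' := by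
    have hd := E.disj
    intro x
    have := hd x
    unfold forceEdge
    grind
  obtain ⟨c1, c2⟩ := moved_forceEdge ih h1.symm hu
  by_cases hv : h (m u) = m u
  · have := c2 hv
    have := E.sum_max _ _ hk E.right hd
    omega
  · have := E.common_max _ _ _ hk E.right E.match_m hd (c1 hv) rfl rfl
    refine absurd this (not_le.2 (common_lt_of (u := u) ?_ ?_ ?_))
    · intro x
      unfold forceEdge
      grind
    · grind
    · unfold forceEdge
      grind

theorem saturated (E : WeakExtremal G h h' m) {v : V} (h1 : m v ≠ v) (h2 : m v ≠ h v)
    (h3 : m v ≠ h' v) : m (h v) ≠ h v := by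
  intro hz
  have ih := E.left.1; have ih' := E.right.1; have im := E.match_m.1
  have hv := E.covered h1 h2 h3
  have hn := isMatchInv_forceEdge E.match_m (E.left.2 v hv).symm
  have c := (moved_forceEdge im hv hz).1 h1
  have := E.common_max _ _ _ E.left E.right hn E.disj rfl rfl c
  refine absurd this (not_le.2 (common_lt_of (u := v) ?_ ?_ ?_))
  · intro x
    unfold forceEdge
    grind
  · grind
  · unfold forceEdge
    grind

theorem tightTriple (E : WeakExtremal G h h' m) : TightTriple G h h' m where
  inv := E.left.1
  inv' := E.right.1
  invm := E.match_m.1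
  adj := E.left.2
  adj' := E.right.2
  adjm := E.match_m.2
  disj := E.disj
  cov _ h1 h2 h3 := ⟨E.covered h1 h2 h3, E.swap.covered h1 h3 h2⟩
  sat _ h1 h2 h3 := ⟨E.saturated h1 h2 h3, E.swap.saturated h1 h3 h2⟩

end WeakExtremal

theorem fixed_dichotomy {h h' : Equiv.Perm V} (ih : ∀ x, h (h x) = x)
    (ih' : ∀ x, h' (h' x) = x) {O : Set V} {x : V} (hx : h x = x)
    (hO : ∀ P : V → Prop, P x → (∀ y, P y → P (h y)) → (∀ y, P y → P (h' y)) → ∀ y ∈ O, P y)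
    {y z : V} (hy : y ∈ O) (hyx : y ≠ x) (hhy : h y = y) (hz : z ∈ O) : h' z ≠ z := by
  intro hhz
  let c : Equiv.Perm V := h' * h
  have conj : ∀ k : ℤ, h ((c ^ k) x) = (c ^ (-k)) x := by
    have hh : h * h = 1 := Equiv.ext ih
    have hh' : h' * h' = 1 := Equiv.ext ih'
    have e : h * c * h⁻¹ = c⁻¹ := by
      rw [mul_inv_rev, inv_eq_of_mul_eq_one_right hh, inv_eq_of_mul_eq_one_right hh',
        mul_assoc, mul_assoc, hh, mul_one]
    intro k
    have : h * c ^ k = c ^ (-k) * h := by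
      rw [zpow_neg, ← inv_zpow, ← e, conj_zpow]
      group
    have := congrArg (fun p : Equiv.Perm V => p x) this
    simpa [hx] using this
  have conj' : ∀ k : ℤ, h' ((c ^ k) x) = (c ^ (1 - k)) x := by
    intro k
    rw [sub_eq_add_neg, zpow_add, zpow_one, Equiv.Perm.mul_apply, ← conj]
    simp [c, ih]
  have horb : ∀ y ∈ O, ∃ k : ℤ, (c ^ k) x = y := by
    refine hO _ ⟨0, rfl⟩ ?_ ?_
    · rintro _ ⟨k, rfl⟩
      exact ⟨-k, (conj k).symm⟩
    · rintro _ ⟨k, rfl⟩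
      exact ⟨1 - k, (conj' k).symm⟩
  obtain ⟨k, rfl⟩ := horb y hy
  obtain ⟨j, rfl⟩ := horb z hz
  rw [conj] at hhy
  rw [conj'] at hhz
  have stab : ∀ p q : ℤ, (c ^ p) x = (c ^ q) x → c ^ (q - p) ∈ MulAction.stabilizer _ x := by
    intro p q e
    rw [MulAction.mem_stabilizer_iff, Equiv.Perm.smul_def, sub_eq_neg_add, zpow_add,
      Equiv.Perm.mul_apply, ← e, ← Equiv.Perm.mul_apply, ← zpow_add]
    simp
  have s1 := Subgroup.zpow_mem _ (stab _ _ hhy) j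
  have s2 := Subgroup.zpow_mem _ (stab _ _ hhz) (-k)
  have s3 := Subgroup.mul_mem _ s1 s2
  rw [← zpow_mul, ← zpow_mul, ← zpow_add] at s3
  rw [show (k - -k) * j + (j - (1 - j)) * -k = k by ring] at s3
  exact hyx s3

theorem ExtremalTriple.weakExtremal [Fintype V] {h h' m : V → V}
    (E : ExtremalTriple G h h' m) : WeakExtremal G h h' m :=
  { E with }

theorem ExtremalTriple.hasDiamondSpanner [Fintype V] {h h' m : V → V}
    (E : ExtremalTriple G h h' m) : HasDiamondSpanner G := by
  classical
  have T := E.weakExtremal.tightTriple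
  let st : Setoid V := Relation.EqvGen.setoid fun x y => y = h x ∨ y = h' x
  let q : V → Quotient st := Quotient.mk st
  have qh : ∀ x, q (h x) = q x := fun x =>
    (Quotient.sound (Relation.EqvGen.rel _ _ (.inl rfl))).symm
  have qh' : ∀ x, q (h' x) = q x := fun x =>
    (Quotient.sound (Relation.EqvGen.rel _ _ (.inr rfl))).symm
  have qind : ∀ P : V → Prop, (∀ y, P (h y) ↔ P y) → (∀ y, P (h' y) ↔ P y) →
      ∀ x y, q x = q y → P x → P y := by
    intro P hP hP' x y hxy
    suffices P x ↔ P y from this.1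
    have := Quotient.exact hxy
    change Relation.EqvGen _ x y at this
    induction this with
    | rel x y hr => rcases hr with rfl | rfl <;> simp [hP, hP']
    | refl x => rfl
    | symm x y _ ih => exact (ih (Quotient.sound ‹_›)).symm
    | trans x y z _ _ ih ih' => exact (ih (Quotient.sound ‹_›)).trans (ih' (Quotient.sound ‹_›))
  obtain ⟨κ, hκ⟩ : ∃ κ, #{x | h x ≠ x ∧ q x = κ} < #{x | m x ≠ x ∧ q x = κ} := by
    by_contra! hle
    refine absurd E.lt (not_lt.2 ?_)
    have key : ∀ f : V → V, moved f = ∑ κ, #{x | f x ≠ x ∧ q x = κ} := by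
      intro f
      rw [moved, Finset.card_eq_sum_card_fiberwise (f := q) (t := Finset.univ) (by simp)]
      simp only [Finset.filter_filter]
    rw [key, key]
    exact Finset.sum_le_sum fun κ _ => hle κ
  let X : Finset V := {x | q x = κ}
  have memX : ∀ x, x ∈ X ↔ q x = κ := fun x => by simp [X]
  have hX : ∀ v, h v ∈ X ↔ v ∈ X := fun v => by rw [memX, memX, qh]
  have hX' : ∀ v, h' v ∈ X ↔ v ∈ X := fun v => by rw [memX, memX, qh']
  have split : ∀ f : V → V, #{x | f x ≠ x ∧ q x = κ} + #{x | f x = x ∧ q x = κ} = #X := by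
    intro f
    rw [add_comm, ← Finset.card_filter_add_card_filter_not (s := X) (fun x => f x = x),
      Finset.filter_filter, Finset.filter_filter]
    simp only [and_comm, ne_eq]
  have flip : #{x | h' x ≠ x ∧ q x = κ} ≤ #{x | h x ≠ x ∧ q x = κ} := by
    have key : ∀ f : V → V, moved f = #{x | f x ≠ x ∧ q x = κ} + #{x | f x ≠ x ∧ q x ≠ κ} := by
      intro f
      rw [moved, ← Finset.card_filter_add_card_filter_not (fun x => q x = κ),
        Finset.filter_filter, Finset.filter_filter]
    let k : V → V := fun x => if q x = κ then h' x else h x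
    let k' : V → V := fun x => if q x = κ then h x else h' x
    have hk : IsMatchInv G k := by
      have := T.inv; have := T.inv'
      refine ⟨fun x => ?_, fun x => ?_⟩
      · simp only [k]
        grind
      · have := T.adj x; have := T.adj' x
        simp only [k]
        split_ifs <;> assumption
    have hk' : IsMatchInv G k' := by
      have := T.inv; have := T.inv'
      refine ⟨fun x => ?_, fun x => ?_⟩
      · simp only [k']
        grind
      · have := T.adj x; have := T.adj' x
        simp only [k']
        split_ifs <;> assumption
    have hd : DisjInv k k' := by
      intro x
      have := T.disj x; have := T.swap.disj x
      simp only [k, k']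
      split_ifs <;> assumption
    have e : moved k = #{x | h' x ≠ x ∧ q x = κ} + #{x | h x ≠ x ∧ q x ≠ κ} := by
      rw [key]
      congr 2 <;> ext x <;> simp only [Finset.mem_filter_univ, k] <;> grind
    have e' : moved k' = #{x | h x ≠ x ∧ q x = κ} + #{x | h' x ≠ x ∧ q x ≠ κ} := by
      rw [key]
      congr 2 <;> ext x <;> simp only [Finset.mem_filter_univ, k'] <;> grind
    have := E.left_max k k' hk hk' hd (by rw [e, e', key h, key h']; omega)
    rw [e, key h] at this
    omega
  have s := split h
  have s' := split h'
  have sm := split m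
  obtain ⟨x, hx⟩ : ({x | h x = x ∧ q x = κ} : Finset V).Nonempty :=
    Finset.card_pos.1 (by omega)
  obtain ⟨z, hz⟩ : ({x | h' x = x ∧ q x = κ} : Finset V).Nonempty :=
    Finset.card_pos.1 (by omega)
  rw [Finset.mem_filter_univ] at hx hz
  have uniq : ∀ y ∈ X, h y = y → y = x := by
    intro y hy hhy
    by_contra hyx
    refine fixed_dichotomy (h := Function.Involutive.toPerm h T.inv)
      (h' := Function.Involutive.toPerm h' T.inv') T.inv T.inv' (O := X) hx.1 ?_ hy hyx hhy
      ((memX z).2 hz.2) hz.1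
    intro P hPx hP hP' y hy
    refine qind P (fun w => ⟨fun hw => ?_, hP w⟩) (fun w => ⟨fun hw => ?_, hP' w⟩) x y ?_ hPx
    · have : P (h (h w)) := hP _ hw
      rwa [T.inv] at this
    · have : P (h' (h' w)) := hP' _ hw
      rwa [T.inv'] at this
    · rw [hx.2, (memX y).1 hy]
  have one : #{x | h x = x ∧ q x = κ} ≤ 1 := by
    refine Finset.card_le_one.2 fun y hy w hw => ?_
    rw [Finset.mem_filter_univ] at hy hw
    rw [uniq y ((memX y).2 hy.2) hy.1, uniq w ((memX w).2 hw.2) hw.1]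
  have hxX : x ∈ X := (memX x).2 hx.2
  refine T.hasDiamondSpanner_of_odd hX hX' ?_ ?_ ?_
  · have hev : Even (X.erase x).card := by
      refine TightTriple.even_card_of_involution T.inv ?_ ?_ <;> intro y hy <;>
        rw [Finset.mem_erase] at hy
      · rw [Finset.mem_erase, hX]
        refine ⟨fun e => hy.1 ?_, hy.2⟩
        rw [← T.inv y, e, hx.1]
      · exact fun e => hy.1 (uniq y hy.2 e)
    rw [← Finset.card_erase_add_one hxX]
    exact hev.add_one
  · intro v hv e
    have : 0 < #{x | m x = x ∧ q x = κ} :=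
      Finset.card_pos.2 ⟨v, by rw [Finset.mem_filter_univ]; exact ⟨e, (memX v).1 hv⟩⟩
    omega
  · intro a ha hU hc
    have n := T.nodup_quad hU hc
    simp only [List.nodup_cons, List.mem_cons, List.not_mem_nil, not_or, or_false,
      not_false_eq_true, List.nodup_nil, and_true] at n
    have : InQuad h h' a x :=
      qind (InQuad h h' a) (fun y => (T.inQuad_closed hc).1) (fun y => (T.inQuad_closed hc).2)
        a x (by rw [hx.2, (memX a).1 ha]) (.inl rfl)
    have i1 := T.inv
    unfold InQuad at this
    grind

theorem exists_matchInv_of_isMatchingSet {M : Finset (Sym2 V)} (hM : IsMatchingSet G M) :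
    ∃ f : V → V, IsMatchInv G f ∧ ∀ v w, s(v, w) ∈ M ↔ f v = w ∧ v ≠ w := by
  classical
  have adj : ∀ {v w}, s(v, w) ∈ M → G.Adj v w := fun hvw => hM.1 hvw
  have uniq : ∀ {v w w'}, s(v, w) ∈ M → s(v, w') ∈ M → w = w' := by
    intro v w w' h1 h2
    by_contra hne
    refine hM.2 _ h1 _ h2 ?_ v (by simp) (by simp)
    exact fun e => hne (Sym2.congr_right.1 e)
  let f : V → V := fun v => if hv : ∃ w, s(v, w) ∈ M then hv.choose else v
  have hf : ∀ v w, s(v, w) ∈ M ↔ f v = w ∧ v ≠ w := by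
    intro v w
    by_cases hv : ∃ w, s(v, w) ∈ M
    · have e : f v = hv.choose := dif_pos hv
      have hs := hv.choose_spec
      rw [← e] at hs
      refine ⟨fun hw => ⟨uniq hs hw, (adj hw).ne⟩, ?_⟩
      rintro ⟨rfl, -⟩
      exact hs
    · have e : f v = v := dif_neg hv
      exact ⟨fun hw => absurd ⟨w, hw⟩ hv, fun hw => absurd (e.symm.trans hw.1) hw.2⟩
  refine ⟨f, ⟨fun v => ?_, fun v hv => ?_⟩, hf⟩
  · by_cases hv : f v = v
    · rw [hv, hv]
    · have := (hf v (f v)).2 ⟨rfl, fun e => hv e.symm⟩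
      rw [Sym2.eq_swap] at this
      exact ((hf _ _).1 this).1
  · exact adj ((hf v (f v)).2 ⟨rfl, hv.symm⟩)

theorem two_mul_card_eq_moved [Fintype V] {M : Finset (Sym2 V)} {f : V → V}
    (hf : ∀ v w, s(v, w) ∈ M ↔ f v = w ∧ v ≠ w) : 2 * M.card = moved f := by
  classical
  rw [moved, Finset.card_eq_sum_card_fiberwise (f := fun v => s(v, f v)) (t := M), mul_comm]
  · refine (Finset.sum_const_nat fun e he => ?_).symm
    induction e with
    | _ v w =>
    obtain ⟨h1, h2⟩ := (hf v w).1 he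
    have h3 : f w = v := ((hf w v).1 (by rwa [Sym2.eq_swap])).1
    rw [Finset.card_eq_two]
    refine ⟨v, w, h2, ?_⟩
    ext x
    simp only [Finset.mem_filter, Finset.mem_univ, true_and, Sym2.eq_iff, Finset.mem_insert,
      Finset.mem_singleton]
    grind
  · intro v hv
    have : f v ≠ v := by simpa using hv
    exact (hf _ _).2 ⟨rfl, this.symm⟩

theorem exists_isMatchingSet_of_matchInv [Fintype V] {f : V → V} (hf : IsMatchInv G f) :
    ∃ M : Finset (Sym2 V), IsMatchingSet G M ∧ ∀ v w, s(v, w) ∈ M ↔ f v = w ∧ v ≠ w := by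
  classical
  let M : Finset (Sym2 V) := ({x | f x ≠ x} : Finset V).image fun v => s(v, f v)
  have hM : ∀ v w, s(v, w) ∈ M ↔ f v = w ∧ v ≠ w := by
    intro v w
    have := hf.1
    simp only [M, Finset.mem_image, Finset.mem_filter_univ, Sym2.eq_iff]
    constructor
    · grind
    · exact fun h => ⟨v, by grind, by grind⟩
  refine ⟨M, ⟨fun e he => ?_, fun e he e' he' hne v hv hv' => hne ?_⟩, hM⟩
  · induction e with
    | _ v w =>
    obtain ⟨rfl, h2⟩ := (hM v w).1 he
    exact hf.2 v h2.symm
  · obtain ⟨w, rfl⟩ := hv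
    obtain ⟨w', rfl⟩ := hv'
    rw [← ((hM _ _).1 he).1, ← ((hM _ _).1 he').1]

theorem disjoint_iff_disjInv {M N : Finset (Sym2 V)} {f g : V → V}
    (hf : ∀ v w, s(v, w) ∈ M ↔ f v = w ∧ v ≠ w) (hg : ∀ v w, s(v, w) ∈ N ↔ g v = w ∧ v ≠ w) :
    Disjoint M N ↔ DisjInv f g := by
  rw [Finset.disjoint_left]
  constructor
  · intro hd v hv e
    exact hd ((hf v (f v)).2 ⟨rfl, hv.symm⟩) ((hg _ _).2 ⟨e, hv.symm⟩)
  · intro hd e he he'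
    induction e with
    | _ v w =>
    obtain ⟨rfl, h2⟩ := (hf v w).1 he
    exact hd v h2.symm ((hg _ _).1 he').1

theorem exists_extremalTriple [Fintype V] (hlt : muG G < nuG G) :
    ∃ h h' m, ExtremalTriple G h h' m := by
  classical
  have bound : ∀ M : Finset (Sym2 V), M.card ≤ Fintype.card (Sym2 V) := Finset.card_le_univ
  have empty : IsMatchingSet G ∅ := ⟨by simp, by simp⟩
  have bν : BddAbove {n | ∃ M : Finset (Sym2 V), IsMatchingSet G M ∧ M.card = n} :=
    ⟨_, by rintro n ⟨M, -, rfl⟩; exact bound M⟩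
  have bl : BddAbove {n | ∃ H H' : Finset (Sym2 V), IsMatchingSet G H ∧ IsMatchingSet G H' ∧
      Disjoint H H' ∧ H.card + H'.card = n} :=
    ⟨_, by rintro n ⟨H, H', -, -, -, rfl⟩; exact add_le_add (bound H) (bound H')⟩
  have bμ : BddAbove {n | ∃ p ∈ LambdaSet G, p.1.card = n} :=
    ⟨_, by rintro n ⟨p, -, rfl⟩; exact bound p.1⟩
  obtain ⟨M, hM, hMc⟩ : nuG G ∈ _ := Nat.sSup_mem ⟨0, ∅, empty, rfl⟩ bν
  obtain ⟨H₀, H₀', h1, h2, h3, h4⟩ : lamG G ∈ _ :=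
    Nat.sSup_mem ⟨0, ∅, ∅, empty, empty, disjoint_bot_left, rfl⟩ bl
  obtain ⟨⟨H, H'⟩, ⟨hH, hH', hd, hsum⟩, hHc⟩ : muG G ∈ _ :=
    Nat.sSup_mem ⟨_, (H₀, H₀'), ⟨h1, h2, h3, h4⟩, rfl⟩ bμ
  simp only at hH hH' hd hsum hHc
  obtain ⟨m₀, mm, hm⟩ := exists_matchInv_of_isMatchingSet hM
  obtain ⟨k₀, mk, hk⟩ := exists_matchInv_of_isMatchingSet hH
  obtain ⟨k₀', mk', hk'⟩ := exists_matchInv_of_isMatchingSet hH'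
  have cm := two_mul_card_eq_moved hm
  have ck := two_mul_card_eq_moved hk
  have ck' := two_mul_card_eq_moved hk'
  have sum_max : ∀ k k', IsMatchInv G k → IsMatchInv G k' → DisjInv k k' →
      moved k + moved k' ≤ moved k₀ + moved k₀' ∧
        (moved k + moved k' = moved k₀ + moved k₀' → moved k ≤ moved k₀) := by
    intro k k' hk hk' hd
    obtain ⟨K, mK, eK⟩ := exists_isMatchingSet_of_matchInv hk
    obtain ⟨K', mK', eK'⟩ := exists_isMatchingSet_of_matchInv hk'
    have hdK := (disjoint_iff_disjInv eK eK').2 hd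
    have cK := two_mul_card_eq_moved eK
    have cK' := two_mul_card_eq_moved eK'
    have hle : K.card + K'.card ≤ lamG G := le_csSup bl ⟨K, K', mK, mK', hdK, rfl⟩
    refine ⟨by omega, fun e => ?_⟩
    have : K.card ≤ muG G := le_csSup bμ ⟨(K, K'), ⟨mK, mK', hdK, by dsimp only; omega⟩, rfl⟩
    omega
  let P : Set ((V → V) × (V → V) × (V → V)) := {t | IsMatchInv G t.1 ∧ IsMatchInv G t.2.1 ∧
    IsMatchInv G t.2.2 ∧ DisjInv t.1 t.2.1 ∧ moved t.1 = moved k₀ ∧ moved t.2.1 = moved k₀' ∧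
    moved t.2.2 = moved m₀}
  obtain ⟨⟨h, h', m⟩, ⟨p1, p2, p3, p4, p5, p6, p7⟩, hmax⟩ :=
    Set.exists_max_image P (fun t => common t.1 t.2.1 t.2.2) (Set.toFinite _)
      ⟨(k₀, k₀', m₀), mk, mk', mm, (disjoint_iff_disjInv hk hk').1 hd, rfl, rfl, rfl⟩
  simp only at p1 p2 p3 p4 p5 p6 p7 hmax
  refine ⟨h, h', m, p1, p2, p3, p4, fun k k' q1 q2 q3 => ?_, fun k k' q1 q2 q3 => ?_,
    fun k k' n q1 q2 q3 q4 q5 q6 q7 => ?_, by omega⟩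
  · rw [p5, p6]
    exact (sum_max k k' q1 q2 q3).1
  · rw [p5, p6]
    exact (sum_max k k' q1 q2 q3).2
  · exact hmax (k, k', n) ⟨q1, q2, q3, q4, q5.trans p5, q6.trans p6, q7.trans p7⟩

end Extremal

/-- If a finite connected graph G has μ(G) < ν(G), then G contains a diamond
spanner as a subgraph: there exist d ≥ 0 and an injective graph homomorphism
from the diamond spanner with d diamonds into G. -/
theorem stmt1 {V : Type*} [Fintype V] (G : SimpleGraph V) (hconn : G.Connected)
    (h : muG G < nuG G) :
    ∃ (d : ℕ) (f : DiamondSpannerV d → V), Function.Injective f ∧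
      ∀ x y : DiamondSpannerV d, (diamondSpanner d).Adj x y → G.Adj (f x) (f y) := by

  obtain ⟨_, _, _, E⟩ := exists_extremalTriple h
  exact E.hasDiamondSpanner
end

section
/- Let G = (V, E) be a finite simple graph and let u, v ∈ V be distinct vertices with uv ∉ E; let Ĝ = (V, E ∪ {uv}). Then λ(Ĝ) > λ(G) if and only if there exists a pair (H, H') ∈ Λ(G) such that u and v are both unsaturated by H, or u and v are both unsaturated by H'. -/
open Finset

section Helpers
variable {V : Type*}

/-- The sizes of pairs of disjoint matchings in a finite graph are bounded. -/
theorem bddAbove_disjointMatchings_card [Fintype V] (G : SimpleGraph V) :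
    BddAbove {n | ∃ H H' : Finset (Sym2 V), IsMatchingSet G H ∧ IsMatchingSet G H' ∧
      Disjoint H H' ∧ H.card + H'.card = n} := by
  classical
  refine ⟨Fintype.card (Sym2 V) + Fintype.card (Sym2 V), ?_⟩
  rintro n ⟨H, H', -, -, -, rfl⟩
  exact add_le_add (card_le_univ H) (card_le_univ H')

theorem card_add_card_le_lamG [Fintype V] {G : SimpleGraph V} {H H' : Finset (Sym2 V)}
    (hH : IsMatchingSet G H) (hH' : IsMatchingSet G H') (hd : Disjoint H H') :
    H.card + H'.card ≤ lamG G :=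
  le_csSup (bddAbove_disjointMatchings_card G) ⟨H, H', hH, hH', hd, rfl⟩

theorem LambdaSet_nonempty [Fintype V] (G : SimpleGraph V) : (LambdaSet G).Nonempty := by
  obtain ⟨H, H', hH, hH', hd, h⟩ := Nat.sSup_mem (s := {n | ∃ H H' : Finset (Sym2 V),
    IsMatchingSet G H ∧ IsMatchingSet G H' ∧ Disjoint H H' ∧ H.card + H'.card = n})
    ⟨0, ∅, ∅, by simp [IsMatchingSet], by simp [IsMatchingSet], by simp, by simp⟩
    (bddAbove_disjointMatchings_card G)
  exact ⟨(H, H'), hH, hH', hd, h⟩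

theorem LambdaSet_swap {G : SimpleGraph V} {H H' : Finset (Sym2 V)}
    (h : (H, H') ∈ LambdaSet G) : (H', H) ∈ LambdaSet G :=
  ⟨h.2.1, h.1, h.2.2.1.symm, (add_comm _ _).trans h.2.2.2⟩

theorem IsMatchingSet.mono {G G' : SimpleGraph V} (hG : G ≤ G') {M : Finset (Sym2 V)}
    (hM : IsMatchingSet G M) : IsMatchingSet G' M :=
  ⟨hM.1.trans (SimpleGraph.edgeSet_mono hG), hM.2⟩

theorem edgeSet_sup_edge (G : SimpleGraph V) {u v : V} (huv : u ≠ v) :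
    (G ⊔ SimpleGraph.fromEdgeSet {s(u, v)}).edgeSet = insert s(u, v) G.edgeSet := by
  ext e
  induction e with | _ a b =>
  simp only [SimpleGraph.mem_edgeSet, SimpleGraph.sup_adj, SimpleGraph.fromEdgeSet_adj,
    Set.mem_insert_iff, Set.mem_singleton_iff]
  constructor
  · tauto
  · rintro (h | h)
    · refine Or.inr ⟨h, ?_⟩
      rintro rfl
      simp only [Sym2.eq_iff] at h
      grind
    · exact Or.inl h

theorem IsMatchingSet.insert_edge [DecidableEq (Sym2 V)] {G : SimpleGraph V} {u v : V}
    (huv : u ≠ v) {M : Finset (Sym2 V)} (hM : IsMatchingSet G M)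
    (hu : ¬ Saturates M u) (hv : ¬ Saturates M v) :
    IsMatchingSet (G ⊔ SimpleGraph.fromEdgeSet {s(u, v)}) (insert s(u, v) M) := by
  refine ⟨?_, ?_⟩
  · rw [edgeSet_sup_edge G huv, coe_insert]
    exact Set.insert_subset_insert hM.1
  · have key : ∀ e ∈ M, ∀ w ∈ e, w ∉ s(u, v) := by
      intro e he w hw h
      rcases Sym2.mem_iff.1 h with rfl | rfl
      · exact hu ⟨e, he, hw⟩
      · exact hv ⟨e, he, hw⟩
    intro e he f hf hef w hwe hwf
    rcases mem_insert.1 he with rfl | he <;> rcases mem_insert.1 hf with rfl | hf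
    · exact hef rfl
    · exact key f hf w hwf hwe
    · exact key e he w hwe hwf
    · exact hM.2 e he f hf hef w hwe hwf

theorem IsMatchingSet.of_notMem {G : SimpleGraph V} {u v : V} (huv : u ≠ v)
    {M : Finset (Sym2 V)} (hM : IsMatchingSet (G ⊔ SimpleGraph.fromEdgeSet {s(u, v)}) M)
    (h : s(u, v) ∉ M) : IsMatchingSet G M := by
  refine ⟨fun e he => ?_, hM.2⟩
  have := hM.1 he
  rw [edgeSet_sup_edge G huv] at this
  rcases this with rfl | h'
  · exact absurd he h
  · exact h'

theorem IsMatchingSet.erase [DecidableEq (Sym2 V)] {G : SimpleGraph V} {M : Finset (Sym2 V)}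
    (hM : IsMatchingSet G M) (e : Sym2 V) : IsMatchingSet G (M.erase e) :=
  ⟨fun _ hf => hM.1 (mem_of_mem_erase hf),
    fun f hf g hg => hM.2 f (mem_of_mem_erase hf) g (mem_of_mem_erase hg)⟩

theorem IsMatchingSet.not_saturates_erase [DecidableEq (Sym2 V)] {G : SimpleGraph V}
    {M : Finset (Sym2 V)} (hM : IsMatchingSet G M) {e : Sym2 V} (he : e ∈ M) {w : V}
    (hw : w ∈ e) : ¬ Saturates (M.erase e) w := by
  rintro ⟨f, hf, hwf⟩
  exact hM.2 e he f (mem_of_mem_erase hf) (ne_of_mem_erase hf).symm w hw hwf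

theorem lamG_lt_lamG_sup_edge [Fintype V] {G : SimpleGraph V} {u v : V} (huv : u ≠ v)
    (hnadj : ¬ G.Adj u v) {H H' : Finset (Sym2 V)} (hp : (H, H') ∈ LambdaSet G)
    (hu : ¬ Saturates H u) (hv : ¬ Saturates H v) :
    lamG G < lamG (G ⊔ SimpleGraph.fromEdgeSet {s(u, v)}) := by
  classical
  obtain ⟨hH, hH', hd, hcard⟩ := hp
  have hnot : ∀ M : Finset (Sym2 V), IsMatchingSet G M → s(u, v) ∉ M :=
    fun M hM h => hnadj (hM.1 h)
  have := card_add_card_le_lamG (hH.insert_edge huv hu hv) (hH'.mono le_sup_left)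
    (disjoint_insert_left.2 ⟨hnot _ hH', hd⟩)
  rw [card_insert_of_notMem (hnot _ hH)] at this
  dsimp only at this hcard
  omega

theorem erase_mem_LambdaSet [Fintype V] [DecidableEq (Sym2 V)] {G : SimpleGraph V} {u v : V}
    (huv : u ≠ v) (hlt : lamG G < lamG (G ⊔ SimpleGraph.fromEdgeSet {s(u, v)}))
    {H H' : Finset (Sym2 V)}
    (hp : (H, H') ∈ LambdaSet (G ⊔ SimpleGraph.fromEdgeSet {s(u, v)})) (he : s(u, v) ∈ H) :
    (H.erase s(u, v), H') ∈ LambdaSet G := by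
  obtain ⟨hH, hH', hd, hcard⟩ := hp
  have h1 : IsMatchingSet G (H.erase s(u, v)) :=
    (hH.erase _).of_notMem huv (notMem_erase _ _)
  have h2 : IsMatchingSet G H' := hH'.of_notMem huv (disjoint_left.1 hd he)
  have hd' : Disjoint (H.erase s(u, v)) H' := hd.mono_left (erase_subset _ _)
  refine ⟨h1, h2, hd', ?_⟩
  have hle := card_add_card_le_lamG h1 h2 hd'
  have := card_erase_add_one he
  dsimp only at hcard ⊢
  omega

end Helpers

/-- Adding a new edge uv to G increases λ iff some pair in Λ(G) leaves both u and v
unsaturated in H, or both unsaturated in H'. -/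
theorem stmt2 {V : Type*} [Fintype V] (G : SimpleGraph V) (u v : V)
    (huv : u ≠ v) (hnadj : ¬ G.Adj u v) :
    lamG (G ⊔ SimpleGraph.fromEdgeSet {s(u, v)}) > lamG G ↔
      ∃ p ∈ LambdaSet G,
        (¬ Saturates p.1 u ∧ ¬ Saturates p.1 v) ∨
        (¬ Saturates p.2 u ∧ ¬ Saturates p.2 v) := by
  classical
  constructor
  · intro hlt
    obtain ⟨⟨H, H'⟩, hp⟩ := LambdaSet_nonempty (G ⊔ SimpleGraph.fromEdgeSet {s(u, v)})
    by_cases he : s(u, v) ∈ H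
    · exact ⟨_, erase_mem_LambdaSet huv hlt hp he,
        Or.inl ⟨hp.1.not_saturates_erase he (Sym2.mem_mk_left u v),
          hp.1.not_saturates_erase he (Sym2.mem_mk_right u v)⟩⟩
    by_cases he' : s(u, v) ∈ H'
    · exact ⟨_, LambdaSet_swap (erase_mem_LambdaSet huv hlt (LambdaSet_swap hp) he'),
        Or.inr ⟨hp.2.1.not_saturates_erase he' (Sym2.mem_mk_left u v),
          hp.2.1.not_saturates_erase he' (Sym2.mem_mk_right u v)⟩⟩
    · have := card_add_card_le_lamG (hp.1.of_notMem huv he) (hp.2.1.of_notMem huv he') hp.2.2.1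
      exact absurd (hp.2.2.2 ▸ this) hlt.not_ge
  · rintro ⟨⟨H, H'⟩, hp, ⟨hu, hv⟩ | ⟨hu, hv⟩⟩
    · exact lamG_lt_lamG_sup_edge huv hnadj hp hu hv
    · exact lamG_lt_lamG_sup_edge huv hnadj (LambdaSet_swap hp) hu hv
end

section
/- Let G be a finite simple graph on n vertices. If G admits two disjoint matchings whose union contains at least n − 1 edges, then μ(G) = ⌊n/2⌋ = ν(G). -/
open Finset

/-- A matching covers two vertices per edge. -/
theorem IsMatchingSet.two_mul_card_le {V : Type*} [Fintype V] [DecidableEq V]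
    {G : SimpleGraph V} {M : Finset (Sym2 V)} (hM : IsMatchingSet G M) :
    2 * M.card ≤ Fintype.card V := by
  have hdisj : (M : Set (Sym2 V)).PairwiseDisjoint Sym2.toFinset := by
    intro e he f hf hef
    refine Finset.disjoint_left.2 fun v hve hvf => ?_
    exact hM.2 e he f hf hef v (Sym2.mem_toFinset.1 hve) (Sym2.mem_toFinset.1 hvf)
  calc 2 * M.card = ∑ e ∈ M, e.toFinset.card := by
        rw [Finset.sum_congr rfl fun e he =>
          Sym2.card_toFinset_of_not_isDiag e (G.not_isDiag_of_mem_edgeSet (hM.1 he))]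
        simp [mul_comm]
    _ = (M.biUnion Sym2.toFinset).card := (Finset.card_biUnion hdisj).symm
    _ ≤ Fintype.card V := Finset.card_le_univ _

/-- If a graph on n vertices admits two disjoint matchings whose union has at
least n - 1 edges, then μ(G) = ⌊n/2⌋ = ν(G). -/
theorem stmt9 {V : Type*} [Fintype V] [DecidableEq V] (G : SimpleGraph V)
    (h : ∃ H H' : Finset (Sym2 V), IsMatchingSet G H ∧ IsMatchingSet G H' ∧
      Disjoint H H' ∧ Fintype.card V - 1 ≤ (H ∪ H').card) :
    muG G = Fintype.card V / 2 ∧ nuG G = Fintype.card V / 2 := by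
  obtain ⟨H, H', hH, hH', hd, hcard⟩ := h
  rw [Finset.card_union_of_disjoint hd] at hcard
  let S := {n | ∃ H H' : Finset (Sym2 V), IsMatchingSet G H ∧ IsMatchingSet G H' ∧
    Disjoint H H' ∧ H.card + H'.card = n}
  have hmem : H.card + H'.card ∈ S := ⟨H, H', hH, hH', hd, rfl⟩
  have hbdd : BddAbove S := by
    refine ⟨Fintype.card V, ?_⟩
    rintro n ⟨A, B, hA, hB, -, rfl⟩
    have := hA.two_mul_card_le
    have := hB.two_mul_card_le
    omega
  have hle : H.card + H'.card ≤ lamG G := le_csSup hbdd hmem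
  obtain ⟨A, B, hA, hB, hAB, hlam⟩ : lamG G ∈ S := Nat.sSup_mem ⟨_, hmem⟩ hbdd
  obtain ⟨p, hp, hpcard⟩ : ∃ p ∈ LambdaSet G, p.1.card = Fintype.card V / 2 := by
    have h1 := hA.two_mul_card_le
    have h2 := hB.two_mul_card_le
    rcases le_total B.card A.card with hBA | hBA
    · exact ⟨(A, B), ⟨hA, hB, hAB, hlam⟩, by dsimp only; omega⟩
    · exact ⟨(B, A), ⟨hB, hA, hAB.symm, by dsimp only; omega⟩, by dsimp only; omega⟩
  constructor
  · refine IsGreatest.csSup_eq ⟨⟨p, hp, hpcard⟩, ?_⟩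
    rintro n ⟨q, hq, rfl⟩
    have := hq.1.two_mul_card_le
    omega
  · refine IsGreatest.csSup_eq ⟨⟨p.1, hp.1, hpcard⟩, ?_⟩
    rintro n ⟨M, hM, rfl⟩
    have := hM.two_mul_card_le
    omega
end
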